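/- Let α, β be real numbers with -1 < β ≤ α < -1/2. Then there exists a function f* ∈ L_{(α,β)} such that |f̂*_{(α,β)}(k)| → ∞ as k → ∞ (in particular, sup_k |f̂*_{(α,β)}(k)| = ∞). -/

import Mathlib

open MeasureTheory Filter Set

noncomputable section

/-- Generalized binomial coefficient `C(a, m) = Γ(a+1)/(Γ(m+1)Γ(a-m+1))`. -/
def genBinom (a : ℝ) (m : ℕ) : ℝ :=
  Real.Gamma (a + 1) / (Real.Gamma ((m : ℝ) + 1) * Real.Gamma (a - (m : ℝ) + 1))

/-- The Jacobi polynomial `P_k^{(α,β)}(x)`. -/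
def jacobiP (α β : ℝ) (k : ℕ) (x : ℝ) : ℝ :=
  ∑ s ∈ Finset.range (k + 1),
    genBinom ((k : ℝ) + α) (k - s) * genBinom ((k : ℝ) + β) s *
      ((x - 1) / 2) ^ s * ((x + 1) / 2) ^ (k - s)

/-- The normalized Jacobi polynomial `R_k^{(α,β)}(x) = P_k^{(α,β)}(x)/P_k^{(α,β)}(1)`. -/
def jacobiR (α β : ℝ) (k : ℕ) (x : ℝ) : ℝ := jacobiP α β k x / jacobiP α β k 1

/-- The Jacobi weight `(sin(θ/2))^{2α+1} (cos(θ/2))^{2β+1}`. -/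
def jacobiWeight (α β : ℝ) (θ : ℝ) : ℝ :=
  Real.sin (θ / 2) ^ (2 * α + 1) * Real.cos (θ / 2) ^ (2 * β + 1)

/-- `f ∈ L_{(α,β)}`: `f` is integrable on `[0,π]` against the Jacobi weight. -/
def MemJacobiL (α β : ℝ) (f : ℝ → ℝ) : Prop :=
  IntegrableOn (fun θ => f θ * jacobiWeight α β θ) (Ioc 0 Real.pi)

/-- The norm `‖f‖_{L_{(α,β)}}`. -/
def jacobiNorm (α β : ℝ) (f : ℝ → ℝ) : ℝ :=
  ∫ θ in Ioc (0 : ℝ) Real.pi, |f θ| * jacobiWeight α β θ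

/-- The `k`-th Fourier–Jacobi coefficient `f̂_{(α,β)}(k)`. -/
def fourierJacobi (α β : ℝ) (f : ℝ → ℝ) (k : ℕ) : ℝ :=
  ∫ θ in Ioc (0 : ℝ) Real.pi, f θ * jacobiR α β k (Real.cos θ) * jacobiWeight α β θ

end

section Orthonormal

variable {μ : Measure ℝ} {p : ℕ → ℝ → ℝ}

theorem integral_sum_mul_of_orthonormal (hint : ∀ g : ℝ → ℝ, Continuous g → Integrable g μ)
    (hp : ∀ k, Continuous (p k))
    (horth : ∀ j k, ∫ x, p j x * p k x ∂μ = if j = k then 1 else 0) (y : ℕ → ℝ) (N m : ℕ) :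
    ∫ x, (∑ k ∈ Finset.range N, y k * p k x) * p m x ∂μ = if m < N then y m else 0 := by
  simp_rw [Finset.sum_mul, mul_assoc]
  rw [integral_finsetSum _ fun k _ => hint _ (by have := hp k; have := hp m; fun_prop)]
  simp_rw [integral_const_mul, horth]
  simp

theorem integral_sum_sq_of_orthonormal (hint : ∀ g : ℝ → ℝ, Continuous g → Integrable g μ)
    (hp : ∀ k, Continuous (p k))
    (horth : ∀ j k, ∫ x, p j x * p k x ∂μ = if j = k then 1 else 0) (y : ℕ → ℝ) (N : ℕ) :
    ∫ x, (∑ k ∈ Finset.range N, y k * p k x) ^ 2 ∂μ = ∑ k ∈ Finset.range N, y k ^ 2 := by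
  have h : ∀ x, (∑ k ∈ Finset.range N, y k * p k x) ^ 2
      = ∑ m ∈ Finset.range N, y m * ((∑ k ∈ Finset.range N, y k * p k x) * p m x) := by
    intro x
    rw [sq, Finset.mul_sum]
    exact Finset.sum_congr rfl fun m _ => by ring
  simp_rw [h]
  rw [integral_finsetSum _ fun m _ => hint _ (by fun_prop)]
  simp_rw [integral_const_mul, integral_sum_mul_of_orthonormal hint hp horth]
  exact Finset.sum_congr rfl fun m hm => by rw [if_pos (Finset.mem_range.1 hm)]; ring

/-- Multiplication by `X` of a finite expansion, when `X` acts by a three-term recurrence. -/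
theorem mul_sum_of_recurrence {X : ℝ → ℝ} {a b : ℕ → ℝ}
    (hrec : ∀ k x,
      X x * p (k + 1) x = a (k + 1) * p (k + 2) x + b (k + 1) * p (k + 1) x + a k * p k x)
    {y : ℕ → ℝ} (hy : y 0 = 0) (M : ℕ) (x : ℝ) :
    ∑ k ∈ Finset.range (M + 1),
        (a (k - 1) * y (k - 1) + b k * y k + a k * y (k + 1)) * p k x
      = X x * ∑ k ∈ Finset.range (M + 1), y k * p k x
        - a M * y M * p (M + 1) x + a M * y (M + 1) * p M x := by
  induction M with
  | zero => simp [hy]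
  | succ M ih =>
    rw [Finset.sum_range_succ, ih, Finset.sum_range_succ _ (M + 1), Nat.add_sub_cancel]
    linear_combination -y (M + 1) * hrec M x

/-- The hat function of height one supported on `[0, 2n]`. -/
noncomputable def hat (n k : ℕ) : ℝ := max 0 (1 - |(k : ℝ) / n - 1|)

theorem hat_nonneg (n k : ℕ) : 0 ≤ hat n k := le_max_left _ _

theorem hat_le_one (n k : ℕ) : hat n k ≤ 1 :=
  max_le zero_le_one (by linarith [abs_nonneg ((k : ℝ) / n - 1)])

theorem hat_le_div (n k : ℕ) : hat n k ≤ k / n :=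
  max_le (by positivity) (by linarith [neg_abs_le ((k : ℝ) / n - 1)])

theorem hat_zero (n : ℕ) : hat n 0 = 0 :=
  le_antisymm (by simpa using hat_le_div n 0) (hat_nonneg n 0)

theorem hat_eq_zero {n k : ℕ} (hn : 0 < n) (h : 2 * n ≤ k) : hat n k = 0 := by
  have h1 : (2 : ℝ) ≤ (k : ℝ) / n := by
    rw [le_div_iff₀ (by positivity)]
    exact_mod_cast h
  exact max_eq_left (by linarith [le_abs_self ((k : ℝ) / n - 1)])

theorem hat_of_le {n k : ℕ} (hn : 0 < n) (h : k ≤ n) : hat n k = k / n := by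
  have h1 : (k : ℝ) / n ≤ 1 := by
    rw [div_le_one (by positivity)]
    exact_mod_cast h
  have h2 : (0 : ℝ) ≤ (k : ℝ) / n := by positivity
  rw [hat, abs_of_nonpos (by linarith), max_eq_right (by linarith)]
  ring

theorem abs_hat_succ_sub_le (n k : ℕ) : |hat n (k + 1) - hat n k| ≤ 1 / n := by
  unfold hat
  refine (abs_max_sub_max_le_max _ _ _ _).trans (max_le (by simp) ?_)
  have h := abs_abs_sub_abs_le ((k : ℝ) / n - 1) (((k + 1 : ℕ) : ℝ) / n - 1)
  have h2 : (k : ℝ) / n - 1 - (((k + 1 : ℕ) : ℝ) / n - 1) = -(1 / n) := by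
    push_cast; ring
  rw [h2, abs_neg, abs_of_nonneg (by positivity : (0 : ℝ) ≤ 1 / n)] at h
  rwa [sub_sub_sub_cancel_left]

/-- The sequence `1, 1, -1, -1, 1, 1, …`. -/
noncomputable def quarterSign (k : ℕ) : ℝ := (-1) ^ (k / 2)

theorem quarterSign_add_two (k : ℕ) : quarterSign (k + 2) = -quarterSign k := by
  simp [quarterSign, pow_succ]

theorem abs_quarterSign (k : ℕ) : |quarterSign k| = 1 := by simp [quarterSign]

theorem abs_recurrence_hat_le {a b : ℕ → ℝ} {M : ℝ}
    (ha : ∀ k : ℕ, |a k - 1 / 2| ≤ M / (k + 1)) (hb : ∀ k : ℕ, |b k| ≤ M / (k + 1))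
    {n : ℕ} (hn : 0 < n) (k : ℕ) :
    |a (k - 1) * (hat n (k - 1) * quarterSign (k - 1)) + b k * (hat n k * quarterSign k)
      + a k * (hat n (k + 1) * quarterSign (k + 1))| ≤ (1 + 5 * M) / n := by
  have hn' : (0 : ℝ) < n := by positivity
  have hM : 0 ≤ M := by simpa using (abs_nonneg _).trans (hb 0)
  have ha' : ∀ k, |a k| ≤ 1 / 2 + M := by
    intro k
    have h1 : M / ((k : ℝ) + 1) ≤ M := div_le_self hM (by linarith [(k.cast_nonneg : (0 : ℝ) ≤ k)])
    have h2 := abs_sub_abs_le_abs_sub (a k) (1 / 2)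
    have h3 := ha k
    rw [abs_of_pos (by norm_num : (0 : ℝ) < 1 / 2)] at h2
    linarith
  rcases k with _ | k
  · have h1 := abs_hat_succ_sub_le n 0
    simp only [hat_zero, sub_zero, zero_add, Nat.zero_sub, zero_mul, mul_zero] at h1 ⊢
    rw [abs_mul, abs_mul, abs_quarterSign, mul_one]
    calc |a 0| * |hat n 1| ≤ (1 / 2 + M) * (1 / n) :=
          mul_le_mul (ha' 0) h1 (abs_nonneg _) (by positivity)
      _ ≤ (1 + 5 * M) / n := by rw [mul_one_div]; gcongr <;> linarith
  · rw [Nat.add_sub_cancel, quarterSign_add_two]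
    have key : a k * (hat n k * quarterSign k) + b (k + 1) * (hat n (k + 1) * quarterSign (k + 1))
        + a (k + 1) * (hat n (k + 1 + 1) * -quarterSign k)
        = -(a (k + 1) * (hat n (k + 1 + 1) - hat n (k + 1)) * quarterSign k)
          - (a (k + 1) - a k) * hat n (k + 1) * quarterSign k
          - a k * (hat n (k + 1) - hat n k) * quarterSign k
          + b (k + 1) * hat n (k + 1) * quarterSign (k + 1) := by ring
    have hk : (0 : ℝ) < (k : ℝ) + 1 := by positivity
    have hhat : hat n (k + 1) ≤ (k + 1) / n := by exact_mod_cast hat_le_div n (k + 1)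
    have h1 : |a (k + 1) * (hat n (k + 1 + 1) - hat n (k + 1)) * quarterSign k|
        ≤ (1 / 2 + M) * (1 / n) := by
      rw [abs_mul, abs_mul, abs_quarterSign, mul_one]
      exact mul_le_mul (ha' _) (abs_hat_succ_sub_le n (k + 1)) (abs_nonneg _) (by positivity)
    have h3 : |a k * (hat n (k + 1) - hat n k) * quarterSign k| ≤ (1 / 2 + M) * (1 / n) := by
      rw [abs_mul, abs_mul, abs_quarterSign, mul_one]
      exact mul_le_mul (ha' _) (abs_hat_succ_sub_le n k) (abs_nonneg _) (by positivity)
    have hMk : M / (((k + 1 : ℕ) : ℝ) + 1) ≤ M / (k + 1) := by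
      push_cast; gcongr; linarith
    have h2 : |(a (k + 1) - a k) * hat n (k + 1) * quarterSign k| ≤ 2 * M / n := by
      rw [abs_mul, abs_mul, abs_quarterSign, mul_one, abs_of_nonneg (hat_nonneg _ _)]
      have h : |a (k + 1) - a k| ≤ 2 * (M / (k + 1)) := by
        have := abs_sub_le (a (k + 1)) (1 / 2) (a k)
        rw [abs_sub_comm (1 / 2)] at this
        linarith [ha (k + 1), ha k]
      calc |a (k + 1) - a k| * hat n (k + 1) ≤ 2 * (M / (k + 1)) * ((k + 1) / n) :=
            mul_le_mul h hhat (hat_nonneg _ _) (by positivity)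
        _ = 2 * M / n := by field_simp
    have h4 : |b (k + 1) * hat n (k + 1) * quarterSign (k + 1)| ≤ M / n := by
      rw [abs_mul, abs_mul, abs_quarterSign, mul_one, abs_of_nonneg (hat_nonneg _ _)]
      calc |b (k + 1)| * hat n (k + 1) ≤ M / (k + 1) * ((k + 1) / n) :=
            mul_le_mul ((hb _).trans hMk) hhat (hat_nonneg _ _) (by positivity)
        _ = M / n := by field_simp
    rw [key]
    have h5 : (1 + 5 * M) / n
        = (1 / 2 + M) * (1 / n) + 2 * M / n + (1 / 2 + M) * (1 / n) + M / n := by ring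
    rw [h5]
    rw [abs_le] at h1 h2 h3 h4 ⊢
    constructor <;> linarith

/-- The trapezoidal kernel `∑ hat n k * quarterSign k * p k`. -/
noncomputable def hatKernel (p : ℕ → ℝ → ℝ) (n : ℕ) (x : ℝ) : ℝ :=
  ∑ k ∈ Finset.range (2 * n + 1), hat n k * quarterSign k * p k x

theorem continuous_hatKernel (hp : ∀ k, Continuous (p k)) (n : ℕ) : Continuous (hatKernel p n) := by
  unfold hatKernel
  fun_prop

/-- Weighted `L²` estimates bound the `L¹` norms of the kernels uniformly. -/
theorem exists_integral_abs_hatKernel_le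
    (hint : ∀ g : ℝ → ℝ, Continuous g → Integrable g μ)
    (hp : ∀ k, Continuous (p k))
    (horth : ∀ j k, ∫ x, p j x * p k x ∂μ = if j = k then 1 else 0)
    {X : ℝ → ℝ} (hX : Continuous X) {a b : ℕ → ℝ}
    (hrec : ∀ k x,
      X x * p (k + 1) x = a (k + 1) * p (k + 2) x + b (k + 1) * p (k + 1) x + a k * p k x)
    {M : ℝ} (ha : ∀ k : ℕ, |a k - 1 / 2| ≤ M / (k + 1)) (hb : ∀ k : ℕ, |b k| ≤ M / (k + 1))
    {C : ℝ} (hC : ∀ n : ℕ, 0 < n → ∫ x, (1 + (n * X x) ^ 2)⁻¹ ∂μ ≤ C / n) :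
    ∃ D, ∀ n : ℕ, 0 < n → ∫ x, |hatKernel p n x| ∂μ ≤ D := by
  refine ⟨(3 + 3 * (1 + 5 * M) ^ 2 + C) / 2, fun n hn => ?_⟩
  have hn' : (1 : ℝ) ≤ n := by exact_mod_cast hn
  have hcK := continuous_hatKernel hp n
  have hden : ∀ x, 1 + ((n : ℝ) * X x) ^ 2 ≠ 0 := fun x => by positivity
  have hcI : Continuous fun x => (1 + ((n : ℝ) * X x) ^ 2)⁻¹ := Continuous.inv₀ (by fun_prop) hden
  have hK2 : ∫ x, hatKernel p n x ^ 2 ∂μ ≤ 3 * n := by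
    unfold hatKernel
    rw [integral_sum_sq_of_orthonormal hint hp horth]
    calc _ ≤ ∑ k ∈ Finset.range (2 * n + 1), (1 : ℝ) := by
          refine Finset.sum_le_sum fun k _ => ?_
          rw [mul_pow, ← sq_abs (quarterSign k), abs_quarterSign]
          have := hat_nonneg n k
          have := hat_le_one n k
          nlinarith
      _ = 2 * n + 1 := by simp
      _ ≤ 3 * n := by linarith
  have hXK2 : ∫ x, (X x * hatKernel p n x) ^ 2 ∂μ ≤ 3 * (1 + 5 * M) ^ 2 / n := by
    have h0 : hat n 0 * quarterSign 0 = 0 := by rw [hat_zero, zero_mul]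
    have hX' : ∀ x, X x * hatKernel p n x = ∑ k ∈ Finset.range (2 * n + 1),
        (a (k - 1) * (hat n (k - 1) * quarterSign (k - 1)) + b k * (hat n k * quarterSign k)
          + a k * (hat n (k + 1) * quarterSign (k + 1))) * p k x := fun x => by
      have h := mul_sum_of_recurrence hrec (y := fun k => hat n k * quarterSign k) h0 (2 * n) x
      rw [hat_eq_zero hn le_rfl, hat_eq_zero hn (Nat.le_succ _)] at h
      simp only [zero_mul, mul_zero, sub_zero, add_zero] at h
      exact h.symm
    simp_rw [hX']
    rw [integral_sum_sq_of_orthonormal hint hp horth]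
    calc _ ≤ ∑ k ∈ Finset.range (2 * n + 1), ((1 + 5 * M) / n) ^ 2 := by
          refine Finset.sum_le_sum fun k _ => ?_
          rw [← sq_abs]
          exact pow_le_pow_left₀ (abs_nonneg _) (abs_recurrence_hat_le ha hb hn k) 2
      _ = (2 * n + 1) * ((1 + 5 * M) / n) ^ 2 := by simp
      _ ≤ 3 * n * ((1 + 5 * M) / n) ^ 2 := by gcongr; linarith
      _ = 3 * (1 + 5 * M) ^ 2 / n := by field_simp
  have hpt : ∀ x, |hatKernel p n x| ≤ 1 / (2 * n) * hatKernel p n x ^ 2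
      + n / 2 * (X x * hatKernel p n x) ^ 2 + n / 2 * (1 + (n * X x) ^ 2)⁻¹ := by
    intro x
    set K := hatKernel p n x
    have h1 : 0 < 1 + ((n : ℝ) * X x) ^ 2 := by positivity
    have h2 : 1 / (2 * n) * K ^ 2 + n / 2 * (X x * K) ^ 2 + n / 2 * (1 + (n * X x) ^ 2)⁻¹ - |K|
        = ((1 + (n * X x) ^ 2) * |K| - n) ^ 2 / (2 * n * (1 + (n * X x) ^ 2)) := by
      rw [mul_pow (X x), ← sq_abs K]
      field_simp
      ring
    have h3 : 0 ≤ ((1 + ((n : ℝ) * X x) ^ 2) * |K| - n) ^ 2 / (2 * n * (1 + (n * X x) ^ 2)) := by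
      positivity
    linarith
  calc ∫ x, |hatKernel p n x| ∂μ
      ≤ ∫ x, (1 / (2 * n) * hatKernel p n x ^ 2
      + n / 2 * (X x * hatKernel p n x) ^ 2 + n / 2 * (1 + (n * X x) ^ 2)⁻¹) ∂μ :=
        integral_mono (hint _ hcK.abs) (hint _ (by fun_prop)) hpt
    _ = 1 / (2 * n) * (∫ x, hatKernel p n x ^ 2 ∂μ)
      + n / 2 * (∫ x, (X x * hatKernel p n x) ^ 2 ∂μ) + n / 2 * ∫ x, (1 + (n * X x) ^ 2)⁻¹ ∂μ := by
        rw [integral_add (hint _ (by fun_prop)) (hint _ (by fun_prop)),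
          integral_add (hint _ (by fun_prop)) (hint _ (by fun_prop))]
        simp_rw [integral_const_mul]
    _ ≤ 1 / (2 * n) * (3 * n) + n / 2 * (3 * (1 + 5 * M) ^ 2 / n) + n / 2 * (C / n) := by
        gcongr
        exact hC n hn
    _ = (3 + 3 * (1 + 5 * M) ^ 2 + C) / 2 := by field_simp

end Orthonormal

theorem integrable_tsum_of_summable_integral_norm {Ω : Type*} [MeasurableSpace Ω] {μ : Measure Ω}
    {F : ℕ → Ω → ℝ} (hF : ∀ i, Integrable (F i) μ) (hsum : Summable fun i => ∫ a, ‖F i a‖ ∂μ) :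
    Integrable (fun a => ∑' i, F i a) μ := by
  have hfin : ∫⁻ a, ∑' i, ‖F i a‖ₑ ∂μ < ⊤ := by
    rw [lintegral_tsum fun i => (hF i).1.enorm]
    simp_rw [← fun i => ofReal_integral_norm_eq_lintegral_enorm (hF i)]
    exact hsum.tsum_ofReal_lt_top
  refine ⟨?_, lt_of_le_of_lt (lintegral_mono fun a => enorm_tsum_le_tsum_enorm) hfin⟩
  refine aestronglyMeasurable_of_tendsto_ae atTop
    (f := fun n a => ∑ i ∈ Finset.range n, F i a)
    (fun n => (integrable_finsetSum _ fun i _ => hF i).1) ?_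
  have hae := ae_lt_top' (AEMeasurable.tsum fun i => (hF i).1.enorm) hfin.ne
  filter_upwards [hae] with a ha
  have hs : Summable fun i => F i a := by
    refine Summable.of_norm ?_
    have := ENNReal.summable_toReal ha.ne
    simpa using this
  exact hs.hasSum.tendsto_sum_nat

section Superposition

variable {μ : Measure ℝ} {p : ℕ → ℝ → ℝ}

/-- A superposition of the kernels is integrable and has slowly decaying coefficients that never
come close to zero. -/
theorem exists_integrable_le_abs_coeff
    (hint : ∀ g : ℝ → ℝ, Continuous g → Integrable g μ)
    (hp : ∀ k, Continuous (p k)) (hpb : ∀ k, ∃ B, ∀ x, |p k x| ≤ B)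
    (horth : ∀ j k, ∫ x, p j x * p k x ∂μ = if j = k then 1 else 0)
    {D : ℝ} (hD : ∀ n : ℕ, 0 < n → ∫ x, |hatKernel p n x| ∂μ ≤ D) {η : ℝ} (hη : 0 < η) :
    ∃ f : ℝ → ℝ, Integrable f μ ∧
      ∀ k : ℕ, 0 < k → (2 * (k : ℝ)) ^ (-η) / 4 ≤ |∫ x, f x * p k x ∂μ| := by
  set s : ℕ → ℝ := fun n => (((n + 1 : ℕ) : ℝ)) ^ (-(1 + η)) with hs
  have hs0 : ∀ n, 0 ≤ s n := fun n => by positivity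
  have hssum : Summable s :=
    (summable_nat_add_iff 1).2 (Real.summable_nat_rpow.2 (by linarith : -(1 + η) < -1))
  have hcK := continuous_hatKernel hp
  refine ⟨fun x => ∑' n, s n * hatKernel p (n + 1) x, ?_, ?_⟩
  · refine integrable_tsum_of_summable_integral_norm
      (fun n => hint _ ((hcK _).const_mul _)) ?_
    refine Summable.of_nonneg_of_le (fun n => integral_nonneg fun _ => norm_nonneg _) (fun n => ?_)
      (hssum.mul_right D)
    simp_rw [norm_mul, integral_const_mul, Real.norm_eq_abs, abs_of_nonneg (hs0 n)]
    exact mul_le_mul_of_nonneg_left (hD _ n.succ_pos) (hs0 n)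
  · intro k hk
    obtain ⟨B, hB⟩ := hpb k
    have hB0 : 0 ≤ B := (abs_nonneg _).trans (hB 0)
    have hcoef : ∀ n, ∫ x, s n * hatKernel p (n + 1) x * p k x ∂μ
        = s n * hat (n + 1) k * quarterSign k := by
      intro n
      simp_rw [mul_assoc, integral_const_mul]
      congr 1
      unfold hatKernel
      rw [integral_sum_mul_of_orthonormal hint hp horth]
      split_ifs with h
      · rfl
      · rw [hat_eq_zero n.succ_pos (by omega), zero_mul]
    have hsum : HasSum (fun n => s n * hat (n + 1) k * quarterSign k)
        (∫ x, (∑' n, s n * hatKernel p (n + 1) x) * p k x ∂μ) := by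
      simp_rw [← hcoef, ← tsum_mul_right]
      refine hasSum_integral_of_summable_integral_norm
        (fun n => hint _ (((hcK _).const_mul _).mul (hp k))) ?_
      refine Summable.of_nonneg_of_le (fun n => integral_nonneg fun _ => norm_nonneg _)
        (fun n => ?_) (hssum.mul_right (D * B))
      simp_rw [mul_assoc, norm_mul, integral_const_mul, Real.norm_eq_abs, abs_of_nonneg (hs0 n)]
      refine mul_le_mul_of_nonneg_left ?_ (hs0 n)
      calc ∫ x, |hatKernel p (n + 1) x| * |p k x| ∂μ
          ≤ ∫ x, |hatKernel p (n + 1) x| * B ∂μ :=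
            integral_mono (hint _ (((hcK _).abs).mul (hp k).abs))
              (hint _ ((hcK _).abs.mul_const _))
              fun x => mul_le_mul_of_nonneg_left (hB x) (abs_nonneg _)
        _ = (∫ x, |hatKernel p (n + 1) x| ∂μ) * B := integral_mul_const _ _
        _ ≤ D * B := mul_le_mul_of_nonneg_right (hD _ n.succ_pos) hB0
    have hsum' := hsum.mul_right (quarterSign k)
    have hq : quarterSign k * quarterSign k = 1 := by
      rw [← abs_mul_abs_self, abs_quarterSign, one_mul]
    simp_rw [mul_assoc, hq, mul_one] at hsum'
    set I := ∫ x, (∑' n, s n * hatKernel p (n + 1) x) * p k x ∂μ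
    have hI : I * quarterSign k ≤ |I| := by
      have := le_abs_self (I * quarterSign k)
      rwa [abs_mul, abs_quarterSign, mul_one] at this
    refine le_trans ?_ hI
    have hk' : (0 : ℝ) < k := by positivity
    calc (2 * (k : ℝ)) ^ (-η) / 4
        = ∑ n ∈ Finset.Ico (k - 1) (2 * k - 1), (2 * (k : ℝ)) ^ (-(1 + η)) * (1 / 2) := by
          have hcard : 2 * k - 1 - (k - 1) = k := by omega
          rw [Finset.sum_const, Nat.card_Ico, hcard, nsmul_eq_mul, neg_add,
            Real.rpow_add (by positivity), Real.rpow_neg_one]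
          field_simp
          norm_num
      _ ≤ ∑ n ∈ Finset.Ico (k - 1) (2 * k - 1), s n * hat (n + 1) k := by
          refine Finset.sum_le_sum fun n hn => ?_
          rw [Finset.mem_Ico] at hn
          have hn2 : ((n + 1 : ℕ) : ℝ) ≤ 2 * k := by exact_mod_cast (by omega : n + 1 ≤ 2 * k)
          have hn0 : (0 : ℝ) < ((n + 1 : ℕ) : ℝ) := by positivity
          rw [hat_of_le n.succ_pos (by omega : k ≤ n + 1)]
          refine mul_le_mul ?_ ?_ (by norm_num) (hs0 n)
          · exact Real.rpow_le_rpow_of_nonpos hn0 hn2 (by linarith)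
          · rw [div_le_div_iff₀ two_pos hn0]
            linarith
      _ ≤ I * quarterSign k :=
          sum_le_hasSum _ (fun n _ => mul_nonneg (hs0 n) (hat_nonneg _ _)) hsum'

end Superposition

section Coefficients

/-- The falling factorial `x (x - 1) ⋯ (x - n + 1)`. -/
noncomputable def fallFac (x : ℝ) (n : ℕ) : ℝ := ∏ i ∈ Finset.range n, (x - i)

/-- The rising factorial `x (x + 1) ⋯ (x + n - 1)`. -/
noncomputable def riseFac (x : ℝ) (n : ℕ) : ℝ := ∏ i ∈ Finset.range n, (x + i)

theorem fallFac_zero (x : ℝ) : fallFac x 0 = 1 := by simp [fallFac]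

theorem riseFac_zero (x : ℝ) : riseFac x 0 = 1 := by simp [riseFac]

theorem fallFac_succ (x : ℝ) (n : ℕ) : fallFac x (n + 1) = fallFac x n * (x - n) :=
  Finset.prod_range_succ _ _

theorem riseFac_succ (x : ℝ) (n : ℕ) : riseFac x (n + 1) = riseFac x n * (x + n) :=
  Finset.prod_range_succ _ _

theorem fallFac_succ' (x : ℝ) (n : ℕ) : fallFac x (n + 1) = x * fallFac (x - 1) n := by
  rw [fallFac, Finset.prod_range_succ', mul_comm]
  congr 1
  · simp
  · exact Finset.prod_congr rfl fun i _ => by push_cast; ring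

theorem riseFac_succ' (x : ℝ) (n : ℕ) : riseFac x (n + 1) = x * riseFac (x + 1) n := by
  rw [riseFac, Finset.prod_range_succ', mul_comm]
  congr 1
  · simp
  · exact Finset.prod_congr rfl fun i _ => by push_cast; ring

theorem riseFac_pos {x : ℝ} (hx : 0 < x) (n : ℕ) : 0 < riseFac x n :=
  Finset.prod_pos fun _ _ => by positivity

theorem riseFac_add (x : ℝ) (m n : ℕ) : riseFac x (m + n) = riseFac x m * riseFac (x + m) n := by
  rw [riseFac, Finset.prod_range_add]
  congr 1
  exact Finset.prod_congr rfl fun i _ => by push_cast; ring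

theorem riseFac_eq_fallFac (x : ℝ) (n : ℕ) : riseFac x n = fallFac (x + n - 1) n := by
  rw [riseFac, fallFac, ← Finset.prod_range_reflect]
  refine Finset.prod_congr rfl fun i hi => ?_
  have hi := Finset.mem_range.1 hi
  rw [Nat.sub_sub, Nat.cast_sub (by omega)]
  push_cast
  ring

theorem fallFac_natCast (k s : ℕ) : fallFac k s = s.factorial * k.choose s := by
  rw [← Nat.cast_mul, ← Nat.descFactorial_eq_factorial_mul_choose]
  induction s with
  | zero => simp [fallFac_zero]
  | succ s ih =>
    rw [fallFac_succ, ih, Nat.descFactorial_succ]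
    rcases le_or_gt s k with h | h
    · push_cast [Nat.cast_sub h]
      ring
    · rw [Nat.descFactorial_of_lt h]
      simp

/-- The Chu–Vandermonde identity. -/
theorem fallFac_add (x y : ℝ) (n : ℕ) :
    fallFac (x + y) n
      = ∑ s ∈ Finset.range (n + 1), n.choose s * (fallFac x s * fallFac y (n - s)) := by
  have h : ∀ (z : ℝ) (m : ℕ), (descPochhammer ℤ m).smeval z = fallFac z m := by
    intro z m
    induction m with
    | zero => simp [fallFac_zero]
    | succ m ih =>
      rw [descPochhammer_succ_right, Polynomial.smeval_mul, ih, fallFac_succ]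
      simp [Polynomial.smeval_sub, Polynomial.smeval_X, Polynomial.smeval_natCast]
  have := Ring.descPochhammer_smeval_add n (Commute.all x y)
  simp_rw [h] at this
  rw [this, Finset.Nat.sum_antidiagonal_eq_sum_range_succ_mk]

theorem Gamma_add_natCast {x : ℝ} (hx : 0 < x) (n : ℕ) :
    Real.Gamma (x + n) = Real.Gamma x * riseFac x n := by
  induction n with
  | zero => simp [riseFac_zero]
  | succ n ih =>
    rw [riseFac_succ, Nat.cast_succ, ← add_assoc, Real.Gamma_add_one (by positivity), ih]
    ring

/-- The coefficients of `R_k^{(α,β)}` in powers of `(x - 1) / 2`, for a real degree. -/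
noncomputable def jacobiCoeff (α β x : ℝ) (s : ℕ) : ℝ :=
  fallFac x s * riseFac (x + (α + β + 1)) s / (s.factorial * riseFac (α + 1) s)

/-- The polynomial `R_k^{(α,β)}` in the variable `u = (x - 1) / 2`. -/
noncomputable def jacobiQ (α β : ℝ) (k : ℕ) (u : ℝ) : ℝ :=
  ∑ s ∈ Finset.range (k + 1), jacobiCoeff α β k s * u ^ s

/-- The coefficient of `R_{k+1}` in the recurrence for `x R_k`. -/
noncomputable def jacobiA (α β x : ℝ) : ℝ :=
  2 * (x + (α + β + 1)) * (x + α + 1) / ((2 * x + (α + β + 1)) * (2 * x + (α + β + 1) + 1))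

/-- The coefficient of `R_{k-1}` in the recurrence for `x R_k`. -/
noncomputable def jacobiC (α β x : ℝ) : ℝ :=
  2 * x * (x + β) / ((2 * x + (α + β + 1)) * (2 * x + (α + β + 1) - 1))

theorem jacobiCoeff_zero (α β x : ℝ) : jacobiCoeff α β x 0 = 1 := by
  simp [jacobiCoeff, fallFac_zero, riseFac_zero]

theorem jacobiCoeff_eq_zero (α β : ℝ) {k s : ℕ} (h : k < s) : jacobiCoeff α β k s = 0 := by
  rw [jacobiCoeff, fallFac_natCast, Nat.choose_eq_zero_of_lt h]
  simp

theorem jacobiCoeff_succ {α : ℝ} (β x : ℝ) (hα : 0 < α + 1) (s : ℕ) :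
    jacobiCoeff α β x (s + 1) * ((s + 1) * (α + 1 + s))
      = jacobiCoeff α β x s * ((x - s) * (x + (α + β + 1) + s)) := by
  have h1 := (riseFac_pos hα s).ne'
  have h2 : (s.factorial : ℝ) ≠ 0 := by positivity
  have h3 : α + 1 + s ≠ 0 := by positivity
  simp only [jacobiCoeff, fallFac_succ, riseFac_succ, Nat.factorial_succ, Nat.cast_mul,
    Nat.cast_succ]
  field_simp

theorem jacobiCoeff_recurrence {α β x : ℝ} (hα : 0 < α + 1) (h0 : 2 * x + (α + β + 1) ≠ 0)
    (h1 : 2 * x + (α + β + 1) + 1 ≠ 0) (h2 : 2 * x + (α + β + 1) - 1 ≠ 0) (s : ℕ) :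
    2 * jacobiCoeff α β x s
      = jacobiA α β x * (jacobiCoeff α β (x + 1) (s + 1) - jacobiCoeff α β x (s + 1))
        + jacobiC α β x * (jacobiCoeff α β (x - 1) (s + 1) - jacobiCoeff α β x (s + 1)) := by
  obtain ⟨c, hc⟩ : ∃ c, c = α + β + 1 := ⟨_, rfl⟩
  obtain rfl : β = c - α - 1 := by linarith
  have hc' : α + (c - α - 1) + 1 = c := by ring
  simp only [jacobiA, jacobiC, jacobiCoeff, hc'] at *
  have e1 : fallFac (x + 1) (s + 1) = (x + 1) * fallFac x s := by
    rw [fallFac_succ', add_sub_cancel_right]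
  have e2 : x * fallFac (x - 1) (s + 1) = fallFac x s * (x - s) * (x - s - 1) := by
    rw [← fallFac_succ', fallFac_succ, fallFac_succ]
    push_cast
    ring
  have e3 : (x + c) * riseFac (x + 1 + c) (s + 1)
      = riseFac (x + c) s * (x + c + s) * (x + c + s + 1) := by
    rw [add_right_comm, ← riseFac_succ', riseFac_succ, riseFac_succ]
    push_cast
    ring
  have e4 : riseFac (x - 1 + c) (s + 1) = (x - 1 + c) * riseFac (x + c) s := by
    rw [riseFac_succ']
    ring_nf
  have hd1 := (riseFac_pos hα s).ne'
  have hd2 : (s.factorial : ℝ) ≠ 0 := by positivity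
  have hd3 : α + 1 + s ≠ 0 := by positivity
  have hd4 : (s : ℝ) + 1 ≠ 0 := by positivity
  have hA : 2 * (x + c) * (x + α + 1) / ((2 * x + c) * (2 * x + c + 1))
      * (fallFac (x + 1) (s + 1) * riseFac (x + 1 + c) (s + 1)
          / ((s + 1).factorial * riseFac (α + 1) (s + 1)))
      = 2 * (x + α + 1) / ((2 * x + c) * (2 * x + c + 1)) * ((x + 1) * fallFac x s)
        * (riseFac (x + c) s * (x + c + s) * (x + c + s + 1))
          / ((s + 1).factorial * riseFac (α + 1) (s + 1)) := by
    rw [e1, ← e3]; ring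
  have hC : 2 * x * (x + (c - α - 1)) / ((2 * x + c) * (2 * x + c - 1))
      * (fallFac (x - 1) (s + 1) * riseFac (x - 1 + c) (s + 1)
          / ((s + 1).factorial * riseFac (α + 1) (s + 1)))
      = 2 * (x + (c - α - 1)) / ((2 * x + c) * (2 * x + c - 1))
        * (fallFac x s * (x - s) * (x - s - 1)) * ((x - 1 + c) * riseFac (x + c) s)
          / ((s + 1).factorial * riseFac (α + 1) (s + 1)) := by
    rw [e4, ← e2]; ring
  rw [mul_sub, mul_sub, hA, hC, fallFac_succ, riseFac_succ, riseFac_succ, Nat.factorial_succ]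
  push_cast
  field_simp
  ring

theorem jacobiQ_eq_sum (α β : ℝ) {k N : ℕ} (h : k < N) (u : ℝ) :
    jacobiQ α β k u = ∑ s ∈ Finset.range N, jacobiCoeff α β k s * u ^ s := by
  refine Finset.sum_subset (Finset.range_mono h) fun s _ hs => ?_
  rw [jacobiCoeff_eq_zero α β (by simpa using hs), zero_mul]

theorem jacobiQ_zero (α β u : ℝ) : jacobiQ α β 0 u = 1 := by
  simp [jacobiQ, jacobiCoeff_zero]

theorem jacobiC_zero (α β : ℝ) : jacobiC α β 0 = 0 := by simp [jacobiC]

theorem jacobiQ_recurrence {α β : ℝ} (hβ : -1 < β) (hβα : β ≤ α) (hα : α < -(1 / 2)) (k : ℕ)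
    (u : ℝ) :
    2 * u * jacobiQ α β k u
      = jacobiA α β k * (jacobiQ α β (k + 1) u - jacobiQ α β k u)
        + jacobiC α β k * (jacobiQ α β (k - 1) u - jacobiQ α β k u) := by
  have hk : k = 0 ∨ (1 : ℝ) ≤ k := by
    rcases k with _ | k
    · exact Or.inl rfl
    · right; push_cast; linarith [(k.cast_nonneg : (0 : ℝ) ≤ k)]
  have h0 : 2 * (k : ℝ) + (α + β + 1) ≠ 0 := by
    rcases hk with rfl | hk
    · intro h; push_cast at h; linarith
    · intro h; linarith
  have h1 : 2 * (k : ℝ) + (α + β + 1) + 1 ≠ 0 := by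
    intro h; linarith [(k.cast_nonneg : (0 : ℝ) ≤ k)]
  have h2 : 2 * (k : ℝ) + (α + β + 1) - 1 ≠ 0 := by
    rcases hk with rfl | hk
    · intro h; push_cast at h; linarith
    · intro h; linarith
  have hcoef := jacobiCoeff_recurrence (by linarith : 0 < α + 1) h0 h1 h2
  have hC : ∀ s, jacobiC α β k * jacobiCoeff α β ((k : ℝ) - 1) s
      = jacobiC α β k * jacobiCoeff α β ((k - 1 : ℕ) : ℝ) s := by
    intro s
    rcases k with _ | k
    · rw [Nat.cast_zero, jacobiC_zero, zero_mul, zero_mul]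
    · simp
  rw [jacobiQ_eq_sum α β (by omega : k < k + 1), jacobiQ_eq_sum α β (by omega : k + 1 < k + 1 + 1),
    jacobiQ_eq_sum α β (by omega : k - 1 < k + 1 + 1)]
  have hk2 := jacobiQ_eq_sum α β (by omega : k < k + 1 + 1) u
  rw [jacobiQ_eq_sum α β (by omega : k < k + 1)] at hk2
  simp_rw [mul_sub]
  nth_rw 2 [hk2]
  nth_rw 2 [hk2]
  simp_rw [← mul_sub, ← Finset.sum_sub_distrib, ← sub_mul, Finset.mul_sum]
  rw [← Finset.sum_add_distrib, Finset.sum_range_succ' _ (k + 1)]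
  simp only [jacobiCoeff_zero, sub_self, zero_mul, mul_zero, add_zero]
  refine Finset.sum_congr rfl fun s _ => ?_
  have h := hcoef s
  push_cast
  linear_combination u ^ (s + 1) * h + u ^ (s + 1) * hC (s + 1)

theorem sum_jacobiCoeff_mul_moment {α β : ℝ} (hβ : -1 < β) (hβα : β ≤ α) {m : ℕ → ℝ}
    (hm : ∀ s : ℕ, (s + α + 1) * m s + (s + 1 + (α + β + 1)) * m (s + 1) = 0) {k : ℕ}
    (hk : 0 < k) : ∑ s ∈ Finset.range (k + 1), jacobiCoeff α β k s * m s = 0 := by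
  set T : ℕ → ℝ := fun s => s * (s + (α + β + 1)) * jacobiCoeff α β k s * m s with hT
  have hk' : (1 : ℝ) ≤ k := by exact_mod_cast hk
  have hne : (k : ℝ) * (k + (α + β + 1)) ≠ 0 :=
    mul_ne_zero (by positivity) (by intro h; linarith)
  have hterm : ∀ s, (k : ℝ) * (k + (α + β + 1)) * (jacobiCoeff α β k s * m s)
      = T s - T (s + 1) := by
    intro s
    have h1 := jacobiCoeff_succ β k (by linarith : 0 < α + 1) s
    simp only [hT]
    push_cast
    linear_combination (-m s) * h1 + jacobiCoeff α β k (s + 1) * (s + 1) * hm s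
  have := Finset.sum_range_sub' T (k + 1)
  simp_rw [← hterm, ← Finset.mul_sum] at this
  have h0 : T 0 - T (k + 1) = 0 := by
    simp [hT, jacobiCoeff_eq_zero α β (Nat.lt_succ_self k)]
  rw [h0] at this
  exact (mul_eq_zero.1 this).resolve_left hne

end Coefficients

section Hypergeometric

theorem genBinom_zero {a : ℝ} (ha : 0 < a + 1) : genBinom a 0 = 1 := by
  have := (Real.Gamma_pos_of_pos ha).ne'
  simp [genBinom, this]

theorem genBinom_natCast_add_pos {α : ℝ} (hα : 0 < α + 1) (k : ℕ) :
    0 < genBinom ((k : ℝ) + α) k := by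
  have h1 : 0 < Real.Gamma ((k : ℝ) + α + 1) :=
    Real.Gamma_pos_of_pos (by linarith [(k.cast_nonneg : (0 : ℝ) ≤ k)])
  have h2 : 0 < Real.Gamma ((k : ℝ) + 1) := Real.Gamma_pos_of_pos (by positivity)
  have h3 : 0 < Real.Gamma ((k : ℝ) + α - k + 1) := Real.Gamma_pos_of_pos (by linarith)
  unfold genBinom
  positivity

theorem genBinom_mul_genBinom {α β : ℝ} (hα : 0 < α + 1) (hβ : 0 < β + 1) {k s : ℕ} (h : s ≤ k) :
    genBinom ((k : ℝ) + α) (k - s) * genBinom ((k : ℝ) + β) s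
      = genBinom ((k : ℝ) + α) k
        * (k.choose s * fallFac ((k : ℝ) + β) s / riseFac (α + 1) s) := by
  have hsk : (0 : ℝ) ≤ (k : ℝ) - s := by
    have : (s : ℝ) ≤ k := by exact_mod_cast h
    linarith
  have e1 : (k : ℝ) + α - ((k - s : ℕ) : ℝ) + 1 = α + 1 + s := by
    push_cast [Nat.cast_sub h]; ring
  have e2 : (k : ℝ) + α - k + 1 = α + 1 := by ring
  have e3 : Real.Gamma ((k : ℝ) + β + 1)
      = Real.Gamma ((k : ℝ) + β - s + 1) * fallFac ((k : ℝ) + β) s := by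
    have := Gamma_add_natCast (by linarith : 0 < (k : ℝ) + β - s + 1) s
    rw [riseFac_eq_fallFac] at this
    rwa [show (k : ℝ) + β - s + 1 + s = k + β + 1 by ring, add_sub_cancel_right] at this
  have hg1 := (Real.Gamma_pos_of_pos hα).ne'
  have hg2 := (Real.Gamma_pos_of_pos (by linarith : 0 < (k : ℝ) + β - s + 1)).ne'
  have hr := (riseFac_pos hα s).ne'
  rw [genBinom, genBinom, genBinom, e1, e2, e3, Gamma_add_natCast hα, Real.Gamma_nat_eq_factorial,
    Real.Gamma_nat_eq_factorial, Real.Gamma_nat_eq_factorial, Nat.cast_choose ℝ h]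
  field_simp

theorem jacobiP_one {α β : ℝ} (hβ : 0 < β + 1) (k : ℕ) :
    jacobiP α β k 1 = genBinom ((k : ℝ) + α) k := by
  rw [jacobiP, Finset.sum_range_succ']
  simp [genBinom_zero (by linarith [(k.cast_nonneg : (0 : ℝ) ≤ k)] : 0 < (k : ℝ) + β + 1)]

theorem jacobiR_eq_jacobiQ {α β : ℝ} (hα : 0 < α + 1) (hβ : 0 < β + 1) (k : ℕ) (x : ℝ) :
    jacobiR α β k x = jacobiQ α β k ((x - 1) / 2) := by
  obtain ⟨u, hu⟩ : ∃ u, u = (x - 1) / 2 := ⟨_, rfl⟩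
  have hu' : (x + 1) / 2 = u + 1 := by rw [hu]; ring
  rw [jacobiR, jacobiP_one hβ, div_eq_iff (genBinom_natCast_add_pos hα k).ne', jacobiP, ← hu, hu',
    mul_comm, jacobiQ]
  have h1 : ∀ s ∈ Finset.range (k + 1),
      genBinom ((k : ℝ) + α) (k - s) * genBinom ((k : ℝ) + β) s * u ^ s * (u + 1) ^ (k - s)
      = genBinom ((k : ℝ) + α) k * ∑ j ∈ Finset.range (k + 1 - s),
        k.choose s * fallFac ((k : ℝ) + β) s / riseFac (α + 1) s * (k - s).choose j
          * u ^ (s + j) := by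
    intro s hs
    have hs : s ≤ k := Nat.lt_succ_iff.1 (Finset.mem_range.1 hs)
    rw [genBinom_mul_genBinom hα hβ hs, add_pow, Nat.sub_add_comm hs, mul_assoc, mul_assoc,
      Finset.mul_sum, Finset.mul_sum]
    congr 1
    refine Finset.sum_congr rfl fun j _ => ?_
    rw [one_pow, pow_add]
    ring
  rw [Finset.sum_congr rfl h1, ← Finset.mul_sum,
    ← Finset.sum_range_diag_flip (k + 1) fun s j =>
      (k.choose s : ℝ) * fallFac ((k : ℝ) + β) s / riseFac (α + 1) s * (k - s).choose j
          * u ^ (s + j)]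
  congr 1
  refine Finset.sum_congr rfl fun t _ => ?_
  have h2 : ∀ s ∈ Finset.range (t + 1),
      (k.choose s : ℝ) * fallFac ((k : ℝ) + β) s / riseFac (α + 1) s * (k - s).choose (t - s)
          * u ^ (s + (t - s))
      = k.choose t / riseFac (α + 1) t * u ^ t
        * (t.choose s * (fallFac ((k : ℝ) + β) s * fallFac (α + t) (t - s))) := by
    intro s hs
    have hs : s ≤ t := Nat.lt_succ_iff.1 (Finset.mem_range.1 hs)
    have hc : (k.choose t : ℝ) * t.choose s = k.choose s * (k - s).choose (t - s) := by
      exact_mod_cast Nat.choose_mul hs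
    have hr : riseFac (α + 1) t = riseFac (α + 1) s * fallFac (α + t) (t - s) := by
      have := riseFac_add (α + 1) s (t - s)
      rw [riseFac_eq_fallFac (α + 1 + s), Nat.add_sub_cancel' hs] at this
      convert this using 3
      push_cast [Nat.cast_sub hs]
      ring
    have hr1 := (riseFac_pos hα s).ne'
    have hr2 := (riseFac_pos hα t).ne'
    have hr3 : fallFac (α + t) (t - s) ≠ 0 := fun h => hr2 (by rw [hr, h, mul_zero])
    rw [Nat.add_sub_cancel' hs, hr]
    field_simp
    linear_combination -u ^ t * fallFac ((k : ℝ) + β) s * hc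
  rw [Finset.sum_congr rfl h2, ← Finset.mul_sum, ← fallFac_add, jacobiCoeff,
    riseFac_eq_fallFac ((k : ℝ) + (α + β + 1)) t, fallFac_natCast]
  have e : (k : ℝ) + β + (α + t) = k + (α + β + 1) + t - 1 := by ring
  have hr2 := (riseFac_pos hα t).ne'
  rw [e]
  field_simp

end Hypergeometric

section Measure

/-- The measure on `(0, π]` whose density is the Jacobi weight. -/
noncomputable def jacobiMeasure (α β : ℝ) : Measure ℝ :=
  (volume.restrict (Ioc 0 Real.pi)).withDensity fun θ => ENNReal.ofReal (jacobiWeight α β θ)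

theorem measurable_jacobiWeight (α β : ℝ) : Measurable (jacobiWeight α β) := by
  unfold jacobiWeight
  fun_prop

theorem jacobiWeight_nonneg (α β : ℝ) {θ : ℝ} (h : θ ∈ Ioc 0 Real.pi) :
    0 ≤ jacobiWeight α β θ := by
  have h1 : 0 ≤ Real.sin (θ / 2) :=
    Real.sin_nonneg_of_nonneg_of_le_pi (by linarith [h.1]) (by linarith [h.1, h.2])
  have h2 : 0 ≤ Real.cos (θ / 2) :=
    Real.cos_nonneg_of_neg_pi_div_two_le_of_le (by linarith [h.1, h.2]) (by linarith [h.1, h.2])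
  unfold jacobiWeight
  positivity

theorem jacobiWeight_pos (α β : ℝ) {θ : ℝ} (h : θ ∈ Ioo 0 Real.pi) :
    0 < jacobiWeight α β θ := by
  have h1 : 0 < Real.sin (θ / 2) :=
    Real.sin_pos_of_pos_of_lt_pi (by linarith [h.1]) (by linarith [h.1, h.2])
  have h2 : 0 < Real.cos (θ / 2) :=
    Real.cos_pos_of_mem_Ioo ⟨by linarith [h.1, h.2], by linarith [h.1, h.2]⟩
  unfold jacobiWeight
  positivity

theorem rpow_le_two_of_half_le {x p : ℝ} (hx : 1 / 2 ≤ x) (hp : -1 < p) (hp0 : p ≤ 0) :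
    x ^ p ≤ 2 := by
  calc x ^ p ≤ (1 / 2) ^ p := Real.rpow_le_rpow_of_nonpos (by norm_num) hx hp0
    _ ≤ (1 / 2) ^ (-1 : ℝ) :=
      Real.rpow_le_rpow_of_exponent_ge (by norm_num) (by norm_num) hp.le
    _ = 2 := by rw [Real.rpow_neg_one]; norm_num

theorem integrableOn_jacobiWeight {α β : ℝ} (hα : -1 < α) (hα' : α < -(1 / 2)) (hβ : -1 < β)
    (hβ' : β < -(1 / 2)) : IntegrableOn (jacobiWeight α β) (Ioc 0 Real.pi) := by
  have hπ := Real.pi_pos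
  have hb1 : IntegrableOn (fun θ : ℝ => θ ^ (2 * α + 1)) (Ioo 0 Real.pi) :=
    (intervalIntegral.intervalIntegrable_rpow' (by linarith)).1.mono_set Ioo_subset_Ioc_self
  have hb2 : IntegrableOn (fun θ : ℝ => (Real.pi - θ) ^ (2 * β + 1)) (Ioo 0 Real.pi) := by
    have := (intervalIntegral.intervalIntegrable_rpow' (a := Real.pi) (b := 0)
      (by linarith : -1 < 2 * β + 1)).comp_sub_left Real.pi
    simp only [sub_self, sub_zero] at this
    exact this.1.mono_set Ioo_subset_Ioc_self
  rw [integrableOn_Ioc_iff_integrableOn_Ioo]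
  refine Integrable.mono' (((hb1.div_const (Real.pi ^ (2 * α + 1))).add
    (hb2.div_const (Real.pi ^ (2 * β + 1)))).const_mul 2)
    (measurable_jacobiWeight α β).aestronglyMeasurable ?_
  refine (ae_restrict_iff' measurableSet_Ioo).2 (Eventually.of_forall fun θ h => ?_)
  rw [Real.norm_of_nonneg (jacobiWeight_pos α β h).le]
  have h1 : θ / Real.pi ≤ Real.sin (θ / 2) := by
    have := Real.mul_le_sin (x := θ / 2) (by linarith [h.1]) (by linarith [h.2])
    calc θ / Real.pi = 2 / Real.pi * (θ / 2) := by ring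
      _ ≤ _ := this
  have h2 : (Real.pi - θ) / Real.pi ≤ Real.cos (θ / 2) := by
    have := Real.mul_le_sin (x := Real.pi / 2 - θ / 2) (by linarith [h.2]) (by linarith [h.1])
    rw [Real.sin_pi_div_two_sub] at this
    calc (Real.pi - θ) / Real.pi = 2 / Real.pi * (Real.pi / 2 - θ / 2) := by ring
      _ ≤ _ := this
  have h3 : 0 < θ / Real.pi := div_pos h.1 hπ
  have h4 : 0 < (Real.pi - θ) / Real.pi := div_pos (by linarith [h.2]) hπ
  have h5 : Real.sin (θ / 2) ^ (2 * α + 1) ≤ θ ^ (2 * α + 1) / Real.pi ^ (2 * α + 1) := by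
    rw [← Real.div_rpow h.1.le hπ.le]
    exact Real.rpow_le_rpow_of_nonpos h3 h1 (by linarith)
  have h6 : Real.cos (θ / 2) ^ (2 * β + 1)
      ≤ (Real.pi - θ) ^ (2 * β + 1) / Real.pi ^ (2 * β + 1) := by
    rw [← Real.div_rpow (by linarith [h.2]) hπ.le]
    exact Real.rpow_le_rpow_of_nonpos h4 h2 (by linarith)
  have hs := h3.trans_le h1
  have hc := h4.trans_le h2
  have hs' := Real.rpow_pos_of_pos hs (2 * α + 1)
  have hc' := Real.rpow_pos_of_pos hc (2 * β + 1)
  simp only [Pi.add_apply, jacobiWeight]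
  rcases le_or_gt (1 / 2) (Real.sin (θ / 2)) with h7 | h7
  · have := rpow_le_two_of_half_le (p := 2 * α + 1) h7 (by linarith) (by linarith)
    nlinarith
  · have h8 : 1 / 2 ≤ Real.cos (θ / 2) := by nlinarith [Real.sin_sq_add_cos_sq (θ / 2)]
    have := rpow_le_two_of_half_le (p := 2 * β + 1) h8 (by linarith) (by linarith)
    nlinarith

theorem integrable_jacobiMeasure_iff (α β : ℝ) (f : ℝ → ℝ) :
    Integrable f (jacobiMeasure α β) ↔ MemJacobiL α β f := by
  rw [jacobiMeasure, integrable_withDensity_iff_integrable_smul'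
    (measurable_jacobiWeight α β).ennreal_ofReal (by simp), MemJacobiL, IntegrableOn]
  refine integrable_congr ((ae_restrict_iff' measurableSet_Ioc).2 (Eventually.of_forall ?_))
  intro θ h
  simp [ENNReal.toReal_ofReal (jacobiWeight_nonneg α β h), mul_comm]

theorem integral_jacobiMeasure (α β : ℝ) (f : ℝ → ℝ) :
    ∫ θ, f θ ∂jacobiMeasure α β = ∫ θ in Ioc 0 Real.pi, f θ * jacobiWeight α β θ := by
  rw [jacobiMeasure, integral_withDensity_eq_integral_toReal_smul
    (measurable_jacobiWeight α β).ennreal_ofReal (by simp)]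
  refine integral_congr_ae ((ae_restrict_iff' measurableSet_Ioc).2 (Eventually.of_forall ?_))
  intro θ h
  simp [ENNReal.toReal_ofReal (jacobiWeight_nonneg α β h), mul_comm]

theorem integrable_jacobiMeasure_of_continuous {α β : ℝ} (hα : -1 < α) (hα' : α < -(1 / 2))
    (hβ : -1 < β) (hβ' : β < -(1 / 2)) {g : ℝ → ℝ} (hg : Continuous g) :
    Integrable g (jacobiMeasure α β) := by
  rw [integrable_jacobiMeasure_iff, MemJacobiL, ← integrableOn_Icc_iff_integrableOn_Ioc]
  have := integrableOn_jacobiWeight hα hα' hβ hβ'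
  rw [← integrableOn_Icc_iff_integrableOn_Ioc] at this
  exact this.continuousOn_mul hg.continuousOn isCompact_Icc

theorem integral_one_jacobiMeasure_pos {α β : ℝ} (hα : -1 < α) (hα' : α < -(1 / 2))
    (hβ : -1 < β) (hβ' : β < -(1 / 2)) : 0 < ∫ _, (1 : ℝ) ∂jacobiMeasure α β := by
  rw [integral_jacobiMeasure]
  simp only [one_mul]
  rw [integral_Ioc_eq_integral_Ioo]
  have hi := integrableOn_jacobiWeight hα hα' hβ hβ'
  rw [integrableOn_Ioc_iff_integrableOn_Ioo] at hi
  rw [setIntegral_pos_iff_support_of_nonneg_ae ((ae_restrict_iff' measurableSet_Ioo).2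
    (Eventually.of_forall fun θ h => (jacobiWeight_pos α β h).le)) hi]
  have : Ioo 0 Real.pi ⊆ Function.support (jacobiWeight α β) ∩ Ioo 0 Real.pi :=
    fun θ h => ⟨(jacobiWeight_pos α β h).ne', h⟩
  refine lt_of_lt_of_le ?_ (measure_mono this)
  simp [Real.pi_pos]

theorem integral_jacobiMeasure_moment {α β : ℝ} (hα : -1 < α) (hα' : α < -(1 / 2))
    (hβ : -1 < β) (hβ' : β < -(1 / 2)) (s : ℕ) :
    (s + α + 1) * ∫ θ, ((Real.cos θ - 1) / 2) ^ s ∂jacobiMeasure α β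
      + (s + 1 + (α + β + 1)) * ∫ θ, ((Real.cos θ - 1) / 2) ^ (s + 1) ∂jacobiMeasure α β = 0 := by
  have hπ := Real.pi_pos
  have hint : ∀ s : ℕ, Integrable (fun θ => ((Real.cos θ - 1) / 2) ^ s) (jacobiMeasure α β) :=
    fun s => integrable_jacobiMeasure_of_continuous hα hα' hβ hβ' (by fun_prop)
  rw [← integral_const_mul, ← integral_const_mul,
    ← integral_add ((hint s).const_mul _) ((hint (s + 1)).const_mul _), integral_jacobiMeasure,
    ← intervalIntegral.integral_of_le hπ.le]
  set G : ℝ → ℝ := fun θ => ((Real.cos θ - 1) / 2) ^ s * (Real.sin (θ / 2) ^ (2 * α + 2)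
    * Real.cos (θ / 2) ^ (2 * β + 2)) with hG
  have hcont : ContinuousOn G (Icc 0 Real.pi) := by
    refine ((by fun_prop : Continuous fun θ => ((Real.cos θ - 1) / 2) ^ s).mul
      (Continuous.mul ?_ ?_)).continuousOn
    · exact (by fun_prop : Continuous fun θ : ℝ => Real.sin (θ / 2)).rpow_const
        fun _ => Or.inr (by linarith)
    · exact (by fun_prop : Continuous fun θ : ℝ => Real.cos (θ / 2)).rpow_const
        fun _ => Or.inr (by linarith)
  rw [intervalIntegral.integral_eq_sub_of_hasDerivAt_of_le hπ.le hcont (fun θ h => ?_)]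
  · have h1 : (0 : ℝ) ^ (2 * α + 2) = 0 := Real.zero_rpow (by linarith)
    have h2 : (0 : ℝ) ^ (2 * β + 2) = 0 := Real.zero_rpow (by linarith)
    simp [hG, h1, h2]
  · rw [intervalIntegrable_iff_integrableOn_Ioc_of_le hπ.le]
    exact (integrable_jacobiMeasure_iff α β _).1
      (((hint s).const_mul _).add ((hint (s + 1)).const_mul _))
  · have h1 : 0 < Real.sin (θ / 2) :=
      Real.sin_pos_of_pos_of_lt_pi (by linarith [h.1]) (by linarith [h.1, h.2])
    have h2 : 0 < Real.cos (θ / 2) :=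
      Real.cos_pos_of_mem_Ioo ⟨by linarith [h.1, h.2], by linarith [h.1, h.2]⟩
    have hu : ∀ θ : ℝ, (Real.cos θ - 1) / 2 = -Real.sin (θ / 2) ^ 2 := by
      intro θ
      have := Real.cos_two_mul (θ / 2)
      rw [mul_div_cancel₀ _ (two_ne_zero)] at this
      rw [this, Real.cos_sq']
      ring
    have hd2 : HasDerivAt (fun θ : ℝ => θ / 2) (1 / 2) θ := (hasDerivAt_id θ).div_const 2
    have hS := hd2.sin
    have hC := hd2.cos
    have hS2 := hS.rpow_const (p := 2 * α + 2) (Or.inl h1.ne')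
    have hC2 := hC.rpow_const (p := 2 * β + 2) (Or.inl h2.ne')
    have hSs := ((hS.pow 2).neg).pow s
    have hG' : G = fun θ => (-Real.sin (θ / 2) ^ 2) ^ s * (Real.sin (θ / 2) ^ (2 * α + 2)
        * Real.cos (θ / 2) ^ (2 * β + 2)) := by
      funext θ; simp only [hG, hu]
    rw [hG']
    refine (hSs.mul (hS2.mul hC2)).congr_deriv ?_
    have e1 : Real.sin (θ / 2) ^ (2 * α + 2)
        = Real.sin (θ / 2) ^ (2 * α + 1) * Real.sin (θ / 2) := by
      rw [← Real.rpow_add_one h1.ne']; ring_nf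
    have e2 : Real.cos (θ / 2) ^ (2 * β + 2)
        = Real.cos (θ / 2) ^ (2 * β + 1) * Real.cos (θ / 2) := by
      rw [← Real.rpow_add_one h2.ne']; ring_nf
    have e3 : 2 * α + 2 - 1 = 2 * α + 1 := by ring
    have e4 : 2 * β + 2 - 1 = 2 * β + 1 := by ring
    have e5 := Real.cos_sq' (θ / 2)
    simp only [hu, jacobiWeight, Pi.mul_apply, Pi.pow_apply, Pi.neg_apply]
    rw [e1, e2, e3, e4]
    generalize Real.sin (θ / 2) ^ (2 * α + 1) = W at *
    generalize Real.cos (θ / 2) ^ (2 * β + 1) = V at *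
    generalize Real.sin (θ / 2) = S at *
    generalize Real.cos (θ / 2) = T at *
    rcases s with _ | s
    · push_cast
      simp
      linear_combination (α + 1) * W * V * e5
    · rw [Nat.add_sub_cancel]
      push_cast
      ring_nf
      simp only [e5]
      ring

theorem inv_one_add_sq_mul_jacobiWeight_le {α β : ℝ} (hα : -1 < α) (hα' : α < -(1 / 2))
    (hβ : -1 < β) (hβ' : β < -(1 / 2)) {n : ℝ} (hn : 1 ≤ n) {θ : ℝ} (h : θ ∈ Ioc 0 Real.pi) :
    (1 + (n * Real.cos θ) ^ 2)⁻¹ * jacobiWeight α β θ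
      ≤ 4 * (1 + (n * (2 / Real.pi) * (θ - Real.pi / 2)) ^ 2)⁻¹ + 4 / n * jacobiWeight α β θ := by
  have hπ := Real.pi_pos
  have hw := jacobiWeight_nonneg α β h
  have hn0 : 0 < n := by linarith
  rcases le_or_gt |Real.cos θ| (1 / 2) with h1 | h1
  · have h2 : jacobiWeight α β θ ≤ 4 := by
      have hc := Real.cos_two_mul (θ / 2)
      rw [mul_div_cancel₀ _ (two_ne_zero)] at hc
      have hsc := Real.sin_sq_add_cos_sq (θ / 2)
      have h1' := abs_le.1 h1
      have h3 : 0 ≤ Real.sin (θ / 2) :=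
        Real.sin_nonneg_of_nonneg_of_le_pi (by linarith [h.1]) (by linarith [h.1, h.2])
      have h4 : 0 ≤ Real.cos (θ / 2) :=
        Real.cos_nonneg_of_neg_pi_div_two_le_of_le (by linarith [h.1, h.2]) (by linarith [h.2])
      have h5 : 1 / 2 ≤ Real.sin (θ / 2) := by nlinarith
      have h6 : 1 / 2 ≤ Real.cos (θ / 2) := by nlinarith
      have h7 := rpow_le_two_of_half_le (p := 2 * α + 1) h5 (by linarith) (by linarith)
      have h8 := rpow_le_two_of_half_le (p := 2 * β + 1) h6 (by linarith) (by linarith)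
      have := mul_le_mul h7 h8 (by positivity) (by norm_num)
      unfold jacobiWeight
      linarith
    have h3 : |2 / Real.pi * (θ - Real.pi / 2)| ≤ |Real.cos θ| := by
      rw [← Real.sin_pi_div_two_sub]
      have := Real.mul_abs_le_abs_sin (x := Real.pi / 2 - θ)
        (abs_le.2 ⟨by linarith [h.2], by linarith [h.1]⟩)
      rwa [abs_mul, abs_of_pos (by positivity : 0 < 2 / Real.pi), abs_sub_comm]
    have h4 : (n * (2 / Real.pi) * (θ - Real.pi / 2)) ^ 2 ≤ (n * Real.cos θ) ^ 2 := by
      rw [mul_assoc, mul_pow, mul_pow n (Real.cos θ)]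
      exact mul_le_mul_of_nonneg_left (sq_le_sq.2 h3) (sq_nonneg _)
    calc (1 + (n * Real.cos θ) ^ 2)⁻¹ * jacobiWeight α β θ
        ≤ (1 + (n * (2 / Real.pi) * (θ - Real.pi / 2)) ^ 2)⁻¹ * 4 := by gcongr
      _ ≤ _ := by
        have : 0 ≤ 4 / n * jacobiWeight α β θ := by positivity
        linarith
  · have h2 : (1 + (n * Real.cos θ) ^ 2)⁻¹ ≤ 4 / n := by
      rw [inv_le_comm₀ (by positivity) (by positivity), inv_div]
      have : (1 / 2) ^ 2 ≤ Real.cos θ ^ 2 := by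
        rw [← sq_abs (Real.cos θ)]
        gcongr
      nlinarith [mul_le_mul_of_nonneg_left this (sq_nonneg n)]
    have := mul_le_mul_of_nonneg_right h2 hw
    have : 0 ≤ 4 * (1 + (n * (2 / Real.pi) * (θ - Real.pi / 2)) ^ 2)⁻¹ := by positivity
    linarith

theorem exists_integral_inv_one_add_sq_le {α β : ℝ} (hα : -1 < α) (hα' : α < -(1 / 2))
    (hβ : -1 < β) (hβ' : β < -(1 / 2)) :
    ∃ C : ℝ, ∀ n : ℕ, 0 < n →
      ∫ θ, (1 + ((n : ℝ) * Real.cos θ) ^ 2)⁻¹ ∂jacobiMeasure α β ≤ C / n := by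
  have hπ := Real.pi_pos
  refine ⟨2 * Real.pi ^ 2 + 4 * ∫ θ in Ioc 0 Real.pi, jacobiWeight α β θ, fun n hn => ?_⟩
  have hn1 : (1 : ℝ) ≤ n := by exact_mod_cast hn
  have hw := integrableOn_jacobiWeight hα hα' hβ hβ'
  set r : ℝ := n * (2 / Real.pi) with hr
  have hr0 : 0 < r := by positivity
  have hk : Integrable fun θ : ℝ => (1 + (r * (θ - Real.pi / 2)) ^ 2)⁻¹ :=
    (integrable_inv_one_add_sq.comp_mul_left' hr0.ne').comp_sub_right (Real.pi / 2)
  have hk' : ∫ θ : ℝ, (1 + (r * (θ - Real.pi / 2)) ^ 2)⁻¹ = r⁻¹ * Real.pi := by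
    rw [integral_sub_right_eq_self (fun θ : ℝ => (1 + (r * θ) ^ 2)⁻¹) (Real.pi / 2),
      Measure.integral_comp_mul_left (fun θ : ℝ => (1 + θ ^ 2)⁻¹) r, integral_univ_inv_one_add_sq,
      abs_of_pos (inv_pos.2 hr0), smul_eq_mul]
  have hcont : Continuous fun θ => (1 + ((n : ℝ) * Real.cos θ) ^ 2)⁻¹ :=
    Continuous.inv₀ (by fun_prop) fun θ => by positivity
  rw [integral_jacobiMeasure]
  calc ∫ θ in Ioc 0 Real.pi, (1 + ((n : ℝ) * Real.cos θ) ^ 2)⁻¹ * jacobiWeight α β θ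
      ≤ ∫ θ in Ioc 0 Real.pi, (4 * (1 + (r * (θ - Real.pi / 2)) ^ 2)⁻¹
          + 4 / n * jacobiWeight α β θ) := by
        refine setIntegral_mono_on ?_ ((hk.integrableOn.const_mul 4).add (hw.const_mul _))
          measurableSet_Ioc fun θ h =>
            inv_one_add_sq_mul_jacobiWeight_le hα hα' hβ hβ' hn1 h
        exact (integrable_jacobiMeasure_iff α β _).1
          (integrable_jacobiMeasure_of_continuous hα hα' hβ hβ' hcont)
    _ = 4 * (∫ θ in Ioc 0 Real.pi, (1 + (r * (θ - Real.pi / 2)) ^ 2)⁻¹)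
          + 4 / n * ∫ θ in Ioc 0 Real.pi, jacobiWeight α β θ := by
        rw [integral_add (hk.integrableOn.const_mul 4) (hw.const_mul _), integral_const_mul,
          integral_const_mul]
    _ ≤ 4 * (r⁻¹ * Real.pi) + 4 / n * ∫ θ in Ioc 0 Real.pi, jacobiWeight α β θ := by
        have h := setIntegral_le_integral (s := Ioc 0 Real.pi) hk
          (Eventually.of_forall fun θ => by positivity)
        rw [hk'] at h
        gcongr
    _ = (2 * Real.pi ^ 2 + 4 * ∫ θ in Ioc 0 Real.pi, jacobiWeight α β θ) / n := by
        rw [hr]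
        field_simp
        ring

end Measure

section ThreeTermRecurrence

variable {μ : Measure ℝ} {R : ℕ → ℝ → ℝ} {X : ℝ → ℝ} {A B C : ℕ → ℝ}

theorem integral_three_term_recurrence (hint : ∀ g : ℝ → ℝ, Continuous g → Integrable g μ)
    (hR : ∀ k, Continuous (R k))
    (hrec : ∀ k x, X x * R k x = A k * R (k + 1) x + B k * R k x + C k * R (k - 1) x) (j k : ℕ) :
    A j * (∫ x, R (j + 1) x * R k x ∂μ) + B j * (∫ x, R j x * R k x ∂μ)
        + C j * (∫ x, R (j - 1) x * R k x ∂μ)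
      = A k * (∫ x, R j x * R (k + 1) x ∂μ) + B k * (∫ x, R j x * R k x ∂μ)
        + C k * (∫ x, R j x * R (k - 1) x ∂μ) := by
  have h : ∀ (m n : ℕ) (a : ℝ), Integrable (fun x => a * (R m x * R n x)) μ := fun m n a =>
    hint _ (((hR m).mul (hR n)).const_mul a)
  have h2 : ∀ (m n m' n' : ℕ) (a b : ℝ),
      Integrable (fun x => a * (R m x * R n x) + b * (R m' x * R n' x)) μ :=
    fun m n m' n' a b => (h m n a).add (h m' n' b)
  simp_rw [← integral_const_mul]
  rw [← integral_add (h _ _ _) (h _ _ _), ← integral_add (h2 _ _ _ _ _ _) (h _ _ _),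
    ← integral_add (h _ _ _) (h _ _ _), ← integral_add (h2 _ _ _ _ _ _) (h _ _ _)]
  congr 1
  funext x
  linear_combination R j x * hrec k x - R k x * hrec j x

theorem integral_mul_eq_zero_of_recurrence (hint : ∀ g : ℝ → ℝ, Continuous g → Integrable g μ)
    (hR : ∀ k, Continuous (R k))
    (hrec : ∀ k x, X x * R k x = A k * R (k + 1) x + B k * R k x + C k * R (k - 1) x)
    (hA : ∀ k, A k ≠ 0) (hC : C 0 = 0) (hR0 : ∀ x, R 0 x = 1)
    (hmean : ∀ k, 0 < k → ∫ x, R k x ∂μ = 0) {j k : ℕ} (hjk : j < k) :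
    ∫ x, R j x * R k x ∂μ = 0 := by
  induction j using Nat.strong_induction_on generalizing k with
  | _ j ih =>
    rcases j with _ | j
    · simp_rw [hR0, one_mul]
      exact hmean k hjk
    · have h := integral_three_term_recurrence hint hR hrec j k
      have hCj : C j * (∫ x, R (j - 1) x * R k x ∂μ) = 0 := by
        rcases j with _ | j
        · rw [hC, zero_mul]
        · rw [ih _ (by omega) (by omega), mul_zero]
      rw [ih j (by omega) (by omega : j < k), ih j (by omega) (by omega : j < k + 1),
        ih j (by omega) (by omega : j < k - 1), hCj] at h
      simpa [hA j] using h

theorem mul_integral_sq_of_recurrence (hint : ∀ g : ℝ → ℝ, Continuous g → Integrable g μ)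
    (hR : ∀ k, Continuous (R k))
    (hrec : ∀ k x, X x * R k x = A k * R (k + 1) x + B k * R k x + C k * R (k - 1) x)
    (hA : ∀ k, A k ≠ 0) (hC : C 0 = 0) (hR0 : ∀ x, R 0 x = 1)
    (hmean : ∀ k, 0 < k → ∫ x, R k x ∂μ = 0) (k : ℕ) :
    C (k + 1) * (∫ x, R k x ^ 2 ∂μ) = A k * ∫ x, R (k + 1) x ^ 2 ∂μ := by
  have h0 : ∀ {j k : ℕ}, j < k → ∫ x, R j x * R k x ∂μ = 0 := fun hjk =>
    integral_mul_eq_zero_of_recurrence hint hR hrec hA hC hR0 hmean hjk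
  have h := integral_three_term_recurrence hint hR hrec k (k + 1)
  have hCk : C k * (∫ x, R (k - 1) x * R (k + 1) x ∂μ) = 0 := by
    rw [h0 (by omega), mul_zero]
  rw [hCk, h0 (by omega : k < k + 1), h0 (by omega : k < k + 1 + 1), Nat.add_sub_cancel] at h
  simp_rw [← sq] at h
  linarith

theorem integral_sq_pos_of_recurrence (hint : ∀ g : ℝ → ℝ, Continuous g → Integrable g μ)
    (hR : ∀ k, Continuous (R k))
    (hrec : ∀ k x, X x * R k x = A k * R (k + 1) x + B k * R k x + C k * R (k - 1) x)
    (hA : ∀ k, 0 < A k) (hC : C 0 = 0) (hC' : ∀ k, 0 < C (k + 1)) (hR0 : ∀ x, R 0 x = 1)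
    (hmean : ∀ k, 0 < k → ∫ x, R k x ∂μ = 0) (hone : 0 < ∫ _, (1 : ℝ) ∂μ) (k : ℕ) :
    0 < ∫ x, R k x ^ 2 ∂μ := by
  induction k with
  | zero => simpa [hR0] using hone
  | succ k ih =>
    have h := mul_integral_sq_of_recurrence hint hR hrec (fun k => (hA k).ne') hC hR0 hmean k
    exact pos_of_mul_pos_right (h ▸ mul_pos (hC' k) ih) (hA k).le

end ThreeTermRecurrence

section Asymptotics

theorem abs_sub_half_le_of_sq {a y : ℝ} (ha : 0 ≤ a) (h : a ^ 2 = y) :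
    |a - 1 / 2| ≤ 2 * |y - 1 / 4| := by
  have h1 : y - 1 / 4 = (a - 1 / 2) * (a + 1 / 2) := by rw [← h]; ring
  rw [h1, abs_mul, abs_of_nonneg (by linarith : 0 ≤ a + 1 / 2)]
  nlinarith [abs_nonneg (a - 1 / 2)]

theorem abs_mul_sub_quarter_le {a b M N t : ℝ} (ha : |a - 1 / 2| ≤ M * t)
    (hb : |b - 1 / 2| ≤ N * t) (hM : 0 ≤ M) (hN : 0 ≤ N) (ht : 0 ≤ t) (ht' : t ≤ 1) :
    |a * b - 1 / 4| ≤ (M * N + M + N) * t := by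
  have h1 : a * b - 1 / 4
      = (a - 1 / 2) * (b - 1 / 2) + ((a - 1 / 2) * (1 / 2) + (b - 1 / 2) * (1 / 2)) := by ring
  have h2 : |(a - 1 / 2) * (b - 1 / 2)| ≤ M * t * (N * t) := by
    rw [abs_mul]
    gcongr
  have h3 := abs_add_le ((a - 1 / 2) * (b - 1 / 2)) ((a - 1 / 2) * (1 / 2) + (b - 1 / 2) * (1 / 2))
  have h4 := abs_add_le ((a - 1 / 2) * (1 / 2)) ((b - 1 / 2) * (1 / 2))
  rw [abs_mul _ (1 / 2), abs_mul _ (1 / 2), abs_of_pos (by norm_num : (0 : ℝ) < 1 / 2)] at h4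
  have h5 : M * t * (N * t) ≤ M * N * t := by
    have := mul_le_mul_of_nonneg_left ht' (by positivity : 0 ≤ M * N * t)
    linarith
  have h6 : 0 ≤ M * t := by positivity
  have h7 : 0 ≤ N * t := by positivity
  rw [h1]
  linarith

theorem exists_forall_abs_le_div_succ {u : ℕ → ℝ} {K : ℝ}
    (h : ∀ᶠ k : ℕ in atTop, |u k| ≤ K / (k + 1)) :
    ∃ M, 0 ≤ M ∧ ∀ k : ℕ, |u k| ≤ M / (k + 1) := by
  have hO : u =O[atTop] fun k : ℕ => 1 / ((k : ℝ) + 1) := by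
    refine Asymptotics.IsBigO.of_bound K (h.mono fun k hk => ?_)
    rw [Real.norm_eq_abs, Real.norm_of_nonneg (by positivity)]
    simpa [div_eq_mul_inv] using hk
  obtain ⟨M, hM, hu⟩ := Asymptotics.bound_of_isBigO_nat_atTop hO
  refine ⟨M, hM.le, fun k => ?_⟩
  have := hu (x := k) (by positivity)
  rw [Real.norm_eq_abs, Real.norm_of_nonneg (by positivity)] at this
  simpa [div_eq_mul_inv] using this

theorem exists_pos_mul_rpow_le {h : ℕ → ℝ} {δ : ℝ} (hpos : ∀ k, 0 < h k) (hδ : 0 ≤ δ)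
    (hδ' : δ ≤ 1) (hh : ∀ᶠ k : ℕ in atTop, h k * (1 + δ / (k + 1)) ≤ h (k + 1)) :
    ∃ c, 0 < c ∧ ∀ᶠ k : ℕ in atTop, c * (k : ℝ) ^ δ ≤ h k := by
  obtain ⟨N, hN⟩ := eventually_atTop.1 hh
  have hc : 0 < h N / ((N : ℝ) + 1) ^ δ := div_pos (hpos N) (by positivity)
  refine ⟨_, hc, eventually_atTop.2 ⟨N, fun k hk => ?_⟩⟩
  have key : h N / ((N : ℝ) + 1) ^ δ * ((k : ℝ) + 1) ^ δ ≤ h k := by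
    induction k, hk using Nat.le_induction with
    | base => exact (div_mul_cancel₀ _ (by positivity)).le
    | succ k hk ih =>
      have h1 : (((k + 1 : ℕ) : ℝ) + 1) = (k + 1) * (1 + 1 / (k + 1)) := by
        push_cast
        field_simp
      have h2 : (1 + 1 / ((k : ℝ) + 1)) ^ δ ≤ 1 + δ * (1 / (k + 1)) :=
        rpow_one_add_le_one_add_mul_self
          (le_trans (by norm_num) (by positivity : (0 : ℝ) ≤ 1 / ((k : ℝ) + 1))) hδ hδ'
      rw [mul_one_div] at h2
      rw [h1, Real.mul_rpow (by positivity) (by positivity), ← mul_assoc]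
      exact (mul_le_mul ih h2 (by positivity) (hpos k).le).trans (hN k hk)
  refine le_trans ?_ key
  gcongr
  linarith

variable {α β : ℝ}

theorem jacobiA_pos (hβ : -1 < β) (hβα : β ≤ α) (hα : α < -(1 / 2)) (k : ℕ) :
    0 < jacobiA α β k := by
  rcases k with _ | k
  · have h : jacobiA α β (0 : ℕ)
        = 2 * (-(α + β + 1)) * (α + 1) / (-(α + β + 1) * (α + β + 1 + 1)) := by
      rw [jacobiA, ← neg_div_neg_eq]
      push_cast
      ring_nf
    rw [h]
    have h1 : 0 < -(α + β + 1) := by linarith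
    have h2 : 0 < α + β + 1 + 1 := by linarith
    have h3 : 0 < α + 1 := by linarith
    positivity
  · have hk : (0 : ℝ) ≤ k := k.cast_nonneg
    rw [jacobiA]
    push_cast
    have h1 : 0 < (k : ℝ) + 1 + (α + β + 1) := by linarith
    have h2 : 0 < (k : ℝ) + 1 + α + 1 := by linarith
    have h3 : 0 < 2 * ((k : ℝ) + 1) + (α + β + 1) := by linarith
    positivity

theorem jacobiC_succ_pos (hβ : -1 < β) (hβα : β ≤ α) (k : ℕ) :
    0 < jacobiC α β ((k + 1 : ℕ) : ℝ) := by
  have hk : (0 : ℝ) ≤ k := k.cast_nonneg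
  rw [jacobiC]
  push_cast
  have h1 : 0 < (k : ℝ) + 1 + β := by linarith
  have h2 : 0 < 2 * ((k : ℝ) + 1) + (α + β + 1) := by linarith
  have h3 : 0 < 2 * ((k : ℝ) + 1) + (α + β + 1) - 1 := by linarith
  positivity

theorem exists_abs_jacobiA_sub_half_le (hβ : -1 < β) (hβα : β ≤ α) (hα : α < -(1 / 2)) :
    ∃ M, 0 ≤ M ∧ ∀ k : ℕ, |jacobiA α β k - 1 / 2| ≤ M / (k + 1) := by
  refine exists_forall_abs_le_div_succ (K := 10) (eventually_atTop.2 ⟨1, fun k hk => ?_⟩)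
  have hk : (1 : ℝ) ≤ k := by exact_mod_cast hk
  obtain ⟨x, hx⟩ : ∃ x : ℝ, x = k := ⟨_, rfl⟩
  obtain ⟨c, hc⟩ : ∃ c, c = α + β + 1 := ⟨_, rfl⟩
  rw [jacobiA, ← hx, ← hc]
  rw [← hx] at hk
  have h1 : x ≤ 2 * x + c := by linarith
  have h2 : x ≤ 2 * x + c + 1 := by linarith
  have e : 2 * (x + c) * (x + α + 1) / ((2 * x + c) * (2 * x + c + 1)) - 1 / 2
      = (x * (4 * α + 2) + (4 * c * (α + 1) - c * (c + 1)))
        / (2 * ((2 * x + c) * (2 * x + c + 1))) := by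
    have : 2 * x + c ≠ 0 := by linarith
    have : 2 * x + c + 1 ≠ 0 := by linarith
    field_simp
    ring
  have h3 : |x * (4 * α + 2) + (4 * c * (α + 1) - c * (c + 1))| ≤ 8 * x := by
    rw [abs_le]
    constructor <;> nlinarith
  have h4 : x * x ≤ (2 * x + c) * (2 * x + c + 1) := by gcongr; linarith
  rw [e, abs_div, abs_of_pos (by nlinarith : 0 < 2 * ((2 * x + c) * (2 * x + c + 1)))]
  calc _ ≤ 8 * x / (2 * (x * x)) := by gcongr
    _ ≤ 10 / (x + 1) := by
      rw [div_le_div_iff₀ (by positivity) (by positivity)]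
      nlinarith

theorem exists_abs_jacobiC_sub_half_le (hβ : -1 < β) (hβα : β ≤ α) (hα : α < -(1 / 2)) :
    ∃ M, 0 ≤ M ∧ ∀ k : ℕ, |jacobiC α β k - 1 / 2| ≤ M / (k + 1) := by
  refine exists_forall_abs_le_div_succ (K := 20) (eventually_atTop.2 ⟨2, fun k hk => ?_⟩)
  have hk : (2 : ℝ) ≤ k := by exact_mod_cast hk
  obtain ⟨x, hx⟩ : ∃ x : ℝ, x = k := ⟨_, rfl⟩
  obtain ⟨c, hc⟩ : ∃ c, c = α + β + 1 := ⟨_, rfl⟩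
  rw [jacobiC, ← hx, ← hc]
  rw [← hx] at hk
  have h1 : x ≤ 2 * x + c := by linarith
  have h2 : x ≤ 2 * x + c - 1 := by linarith
  have e : 2 * x * (x + β) / ((2 * x + c) * (2 * x + c - 1)) - 1 / 2
      = (x * (4 * β - 2 * (2 * c - 1)) - c * (c - 1))
        / (2 * ((2 * x + c) * (2 * x + c - 1))) := by
    have : 2 * x + c ≠ 0 := by linarith
    have : 2 * x + c - 1 ≠ 0 := by linarith
    field_simp
    ring
  have h3 : |x * (4 * β - 2 * (2 * c - 1)) - c * (c - 1)| ≤ 12 * x := by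
    rw [abs_le]
    constructor <;> nlinarith
  have h4 : x * x ≤ (2 * x + c) * (2 * x + c - 1) := by gcongr; linarith
  rw [e, abs_div, abs_of_pos (by nlinarith : 0 < 2 * ((2 * x + c) * (2 * x + c - 1)))]
  calc _ ≤ 12 * x / (2 * (x * x)) := by gcongr
    _ ≤ 20 / (x + 1) := by
      rw [div_le_div_iff₀ (by positivity) (by positivity)]
      nlinarith

theorem cubic_nonneg {a b c d x : ℝ} (ha : 0 < a) (hx : 1 ≤ x) (h : (|b| + |c| + |d|) / a ≤ x) :
    0 ≤ a * x ^ 3 + b * x ^ 2 + c * x + d := by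
  rw [div_le_iff₀ ha] at h
  have h1 := mul_le_mul_of_nonneg_right h (sq_nonneg x)
  have hx2 : x ≤ x ^ 2 := by nlinarith
  have h2 : |c| * x ≤ |c| * x ^ 2 := by gcongr
  have h3 : |d| * 1 ≤ |d| * x ^ 2 := by gcongr; linarith
  have h4 := mul_le_mul_of_nonneg_right (neg_abs_le b) (sq_nonneg x)
  have h5 := mul_le_mul_of_nonneg_right (neg_abs_le c) (by linarith : 0 ≤ x)
  have h6 := neg_abs_le d
  nlinarith

theorem eventually_jacobiA_mul_le_jacobiC (hβ : -1 < β) (hβα : β ≤ α) (hα : α < -(1 / 2)) :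
    ∀ᶠ k : ℕ in atTop, jacobiA α β k * (1 + (-1 - 2 * α) / 2 / (k + 1))
      ≤ jacobiC α β ((k + 1 : ℕ) : ℝ) := by
  obtain ⟨δ, hδ⟩ : ∃ δ, δ = (-1 - 2 * α) / 2 := ⟨_, rfl⟩
  obtain ⟨c, hc⟩ : ∃ c, c = α + β + 1 := ⟨_, rfl⟩
  have hδ0 : 0 < 2 * δ := by linarith
  set e2 : ℝ := 2 + 2 * (c + 2 * (1 + β)) + c * (1 + β)
    - ((α + 1) * (c + 2) + (1 + δ + c) * (c + 2 + 2 * (α + 1)) + 2 * (1 + δ) * c) with he2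
  set e1 : ℝ := c + 2 * (1 + β) + 2 * c * (1 + β)
    - ((1 + δ + c) * (α + 1) * (c + 2) + (1 + δ) * c * (c + 2 + 2 * (α + 1))) with he1
  set e0 : ℝ := c * (1 + β) - (1 + δ) * c * (α + 1) * (c + 2) with he0
  obtain ⟨N, hN⟩ := exists_nat_ge ((|e2| + |e1| + |e0|) / (2 * δ))
  refine eventually_atTop.2 ⟨max N 1, fun k hk => ?_⟩
  have hk1 : (1 : ℝ) ≤ k := by exact_mod_cast (le_max_right _ _).trans hk
  have hkN : (N : ℝ) ≤ k := by exact_mod_cast (le_max_left _ _).trans hk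
  have hcub := cubic_nonneg hδ0 hk1 (hN.trans hkN)
  rw [jacobiA, jacobiC, ← hδ, ← hc]
  push_cast
  generalize (k : ℝ) = x at *
  have h1 : 0 < 2 * x + c := by linarith
  have h2 : 0 < x + c := by linarith
  have h3 : 0 < x + α + 1 := by linarith
  have h4 : 2 * (x + 1) + c - 1 = 2 * x + c + 1 := by ring
  have h5 : 0 < 2 * x + c + 1 := by linarith
  have h6 : 0 < 2 * (x + 1) + c := by linarith
  rw [h4, one_add_div (by linarith), div_mul_div_comm,
    div_le_div_iff₀ (by positivity) (by positivity)]
  have hid : (2 * x + c) * (x + 1 + β) * (x + 1) ^ 2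
      - (x + 1 + δ) * (x + c) * (x + α + 1) * (2 * (x + 1) + c)
      = 2 * δ * x ^ 3 + e2 * x ^ 2 + e1 * x + e0 := by
    rw [he2, he1, he0, hδ, hc]
    ring
  rw [← hid] at hcub
  have := mul_nonneg (by positivity : 0 ≤ 2 * (2 * x + c + 1)) hcub
  linarith

end Asymptotics

section Construction

variable {α β : ℝ}

theorem continuous_jacobiQ_comp_cos (α β : ℝ) (k : ℕ) :
    Continuous fun θ => jacobiQ α β k ((Real.cos θ - 1) / 2) := by
  unfold jacobiQ
  fun_prop

theorem exists_abs_jacobiQ_comp_cos_le (α β : ℝ) (k : ℕ) :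
    ∃ B, ∀ θ, |jacobiQ α β k ((Real.cos θ - 1) / 2)| ≤ B := by
  refine ⟨∑ s ∈ Finset.range (k + 1), |jacobiCoeff α β k s|, fun θ => ?_⟩
  refine (Finset.abs_sum_le_sum_abs _ _).trans (Finset.sum_le_sum fun s _ => ?_)
  have h : |(Real.cos θ - 1) / 2| ≤ 1 := by
    rw [abs_le]
    constructor <;> linarith [Real.neg_one_le_cos θ, Real.cos_le_one θ]
  rw [abs_mul, abs_pow]
  exact mul_le_of_le_one_right (abs_nonneg _) (pow_le_one₀ (abs_nonneg _) h)

theorem integral_jacobiQ_comp_cos (hβ : -1 < β) (hβα : β ≤ α) (hα : α < -(1 / 2)) {k : ℕ}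
    (hk : 0 < k) : ∫ θ, jacobiQ α β k ((Real.cos θ - 1) / 2) ∂jacobiMeasure α β = 0 := by
  simp only [jacobiQ]
  rw [integral_finsetSum _ fun s _ => integrable_jacobiMeasure_of_continuous (by linarith) hα hβ
    (by linarith) (by fun_prop)]
  simp_rw [integral_const_mul]
  exact sum_jacobiCoeff_mul_moment hβ hβα
    (integral_jacobiMeasure_moment (by linarith) hα hβ (by linarith)) hk

/-- The squared norm of `R_k^{(α,β)}` in `L²` of the Jacobi measure. -/
noncomputable def jacobiNormSq (α β : ℝ) (k : ℕ) : ℝ :=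
  ∫ θ, jacobiQ α β k ((Real.cos θ - 1) / 2) ^ 2 ∂jacobiMeasure α β

theorem cos_mul_jacobiQ (hβ : -1 < β) (hβα : β ≤ α) (hα : α < -(1 / 2)) (k : ℕ) (θ : ℝ) :
    Real.cos θ * jacobiQ α β k ((Real.cos θ - 1) / 2)
      = jacobiA α β k * jacobiQ α β (k + 1) ((Real.cos θ - 1) / 2)
        + (1 - jacobiA α β k - jacobiC α β k) * jacobiQ α β k ((Real.cos θ - 1) / 2)
        + jacobiC α β k * jacobiQ α β (k - 1) ((Real.cos θ - 1) / 2) := by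
  linear_combination jacobiQ_recurrence hβ hβα hα k ((Real.cos θ - 1) / 2)

theorem jacobiNormSq_pos (hβ : -1 < β) (hβα : β ≤ α) (hα : α < -(1 / 2)) (k : ℕ) :
    0 < jacobiNormSq α β k :=
  integral_sq_pos_of_recurrence (X := Real.cos) (A := fun k => jacobiA α β k)
    (B := fun k => 1 - jacobiA α β k - jacobiC α β k) (C := fun k => jacobiC α β k)
    (R := fun k θ => jacobiQ α β k ((Real.cos θ - 1) / 2))
    (fun _ hg => integrable_jacobiMeasure_of_continuous (by linarith) hα hβ (by linarith) hg)
    (continuous_jacobiQ_comp_cos α β) (cos_mul_jacobiQ hβ hβα hα) (jacobiA_pos hβ hβα hα)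
    (by rw [Nat.cast_zero, jacobiC_zero]) (jacobiC_succ_pos hβ hβα)
    (fun θ => jacobiQ_zero α β _) (fun _ hk => integral_jacobiQ_comp_cos hβ hβα hα hk)
    (integral_one_jacobiMeasure_pos (by linarith) hα hβ (by linarith)) k

theorem jacobiC_mul_jacobiNormSq (hβ : -1 < β) (hβα : β ≤ α) (hα : α < -(1 / 2)) (k : ℕ) :
    jacobiC α β ((k + 1 : ℕ) : ℝ) * jacobiNormSq α β k
      = jacobiA α β k * jacobiNormSq α β (k + 1) :=
  mul_integral_sq_of_recurrence (X := Real.cos) (A := fun k => jacobiA α β k)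
    (B := fun k => 1 - jacobiA α β k - jacobiC α β k) (C := fun k => jacobiC α β k)
    (R := fun k θ => jacobiQ α β k ((Real.cos θ - 1) / 2))
    (fun _ hg => integrable_jacobiMeasure_of_continuous (by linarith) hα hβ (by linarith) hg)
    (continuous_jacobiQ_comp_cos α β) (cos_mul_jacobiQ hβ hβα hα)
    (fun k => (jacobiA_pos hβ hβα hα k).ne') (by rw [Nat.cast_zero, jacobiC_zero])
    (fun θ => jacobiQ_zero α β _) (fun _ hk => integral_jacobiQ_comp_cos hβ hβα hα hk) k

theorem integral_jacobiQ_mul_jacobiQ (hβ : -1 < β) (hβα : β ≤ α) (hα : α < -(1 / 2)) {j k : ℕ}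
    (hjk : j ≠ k) :
    ∫ θ, jacobiQ α β j ((Real.cos θ - 1) / 2) * jacobiQ α β k ((Real.cos θ - 1) / 2)
      ∂jacobiMeasure α β = 0 := by
  have key : ∀ {j k : ℕ}, j < k → _ := fun {j k} hjk =>
    integral_mul_eq_zero_of_recurrence (X := Real.cos) (A := fun k => jacobiA α β k)
      (B := fun k => 1 - jacobiA α β k - jacobiC α β k) (C := fun k => jacobiC α β k)
      (R := fun k θ => jacobiQ α β k ((Real.cos θ - 1) / 2)) (j := j) (k := k)
      (fun _ hg => integrable_jacobiMeasure_of_continuous (by linarith) hα hβ (by linarith) hg)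
      (continuous_jacobiQ_comp_cos α β) (cos_mul_jacobiQ hβ hβα hα)
      (fun k => (jacobiA_pos hβ hβα hα k).ne') (by rw [Nat.cast_zero, jacobiC_zero])
      (fun θ => jacobiQ_zero α β _) (fun _ hk => integral_jacobiQ_comp_cos hβ hβα hα hk) hjk
  rcases lt_or_gt_of_ne hjk with h | h
  · exact key h
  · simp_rw [mul_comm (jacobiQ α β j _)]
    exact key h

theorem exists_pos_mul_rpow_le_jacobiNormSq (hβ : -1 < β) (hβα : β ≤ α) (hα : α < -(1 / 2)) :
    ∃ c, 0 < c ∧ ∀ᶠ k : ℕ in atTop, c * (k : ℝ) ^ ((-1 - 2 * α) / 2) ≤ jacobiNormSq α β k := by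
  refine exists_pos_mul_rpow_le (jacobiNormSq_pos hβ hβα hα) (by linarith) (by linarith) ?_
  filter_upwards [eventually_jacobiA_mul_le_jacobiC hβ hβα hα] with k hk
  have h1 := jacobiC_mul_jacobiNormSq hβ hβα hα k
  have h2 := mul_le_mul_of_nonneg_right hk (jacobiNormSq_pos hβ hβα hα k).le
  refine le_of_mul_le_mul_left ?_ (jacobiA_pos hβ hβα hα k)
  linarith

theorem exists_integrable_le_abs_integral_jacobiQ (hβ : -1 < β) (hβα : β ≤ α)
    (hα : α < -(1 / 2)) {η : ℝ} (hη : 0 < η) :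
    ∃ f, Integrable f (jacobiMeasure α β) ∧ ∀ k : ℕ, 0 < k →
      √(jacobiNormSq α β k) * ((2 * (k : ℝ)) ^ (-η) / 4)
        ≤ |∫ θ, f θ * jacobiQ α β k ((Real.cos θ - 1) / 2) ∂jacobiMeasure α β| := by
  set r : ℕ → ℝ := fun k => √(jacobiNormSq α β k) with hr
  have hpos := jacobiNormSq_pos hβ hβα hα
  have hr0 : ∀ k, 0 < r k := fun k => Real.sqrt_pos.2 (hpos k)
  have hr2 : ∀ k, r k ^ 2 = jacobiNormSq α β k := fun k => Real.sq_sqrt (hpos k).le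
  set p : ℕ → ℝ → ℝ := fun k θ => jacobiQ α β k ((Real.cos θ - 1) / 2) / r k with hp
  set a : ℕ → ℝ := fun k => jacobiA α β k * r (k + 1) / r k with ha
  set b : ℕ → ℝ := fun k => 1 - jacobiA α β k - jacobiC α β k with hb
  have hint : ∀ g : ℝ → ℝ, Continuous g → Integrable g (jacobiMeasure α β) := fun _ hg =>
    integrable_jacobiMeasure_of_continuous (by linarith) hα hβ (by linarith) hg
  have hpc : ∀ k, Continuous (p k) := fun k => (continuous_jacobiQ_comp_cos α β k).div_const _
  have hac : ∀ k, a k * r k = jacobiA α β k * r (k + 1) := fun k =>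
    div_mul_cancel₀ _ (hr0 k).ne'
  have hac' : ∀ k, jacobiC α β ((k + 1 : ℕ) : ℝ) * r k = a k * r (k + 1) := fun k => by
    have h := jacobiC_mul_jacobiNormSq hβ hβα hα k
    rw [← hr2, ← hr2] at h
    refine mul_right_cancel₀ (hr0 k).ne' ?_
    linear_combination h - r (k + 1) * hac k
  have hrec : ∀ k x, Real.cos x * p (k + 1) x
      = a (k + 1) * p (k + 2) x + b (k + 1) * p (k + 1) x + a k * p k x := by
    intro k x
    have h := cos_mul_jacobiQ hβ hβα hα (k + 1) x
    rw [Nat.add_sub_cancel] at h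
    have h1 : jacobiA α β ((k + 1 : ℕ) : ℝ) = a (k + 1) * r (k + 1) / r (k + 2) := by
      rw [hac, mul_div_cancel_right₀ _ (hr0 _).ne']
    have h2 : jacobiC α β ((k + 1 : ℕ) : ℝ) = a k * r (k + 1) / r k := by
      rw [← hac', mul_div_cancel_right₀ _ (hr0 _).ne']
    have e0 := (hr0 k).ne'
    have e1 := (hr0 (k + 1)).ne'
    have e2 := (hr0 (k + 2)).ne'
    have h3 : Real.cos x * p (k + 1) x
        = (Real.cos x * jacobiQ α β (k + 1) ((Real.cos x - 1) / 2)) / r (k + 1) :=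
      (mul_div_assoc _ _ _).symm
    rw [h3, h]
    change (_ + b (k + 1) * _ + _) / _ = _
    rw [h1, h2]
    simp only [hp]
    field_simp
  have horth : ∀ j k, ∫ θ, p j θ * p k θ ∂jacobiMeasure α β = if j = k then 1 else 0 := by
    intro j k
    simp only [hp, div_mul_div_comm]
    rw [integral_div]
    split_ifs with h
    · subst h
      simp_rw [← sq]
      rw [hr2]
      exact div_self (hpos j).ne'
    · rw [integral_jacobiQ_mul_jacobiQ hβ hβα hα h, zero_div]
  obtain ⟨M, hM, hAM⟩ := exists_abs_jacobiA_sub_half_le hβ hβα hα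
  obtain ⟨N, hN, hCN⟩ := exists_abs_jacobiC_sub_half_le hβ hβα hα
  have hle : ∀ k : ℕ, (M + N) / ((k : ℝ) + 1) ≤ 2 * (M * N + M + N) / (k + 1) := fun k => by
    gcongr
    nlinarith [mul_nonneg hM hN]
  have haM : ∀ k : ℕ, |a k - 1 / 2| ≤ 2 * (M * N + M + N) / (k + 1) := by
    intro k
    have ha0 : 0 ≤ a k :=
      div_nonneg (mul_nonneg (jacobiA_pos hβ hβα hα k).le (hr0 _).le) (hr0 _).le
    have ha2 : a k ^ 2 = jacobiA α β k * jacobiC α β ((k + 1 : ℕ) : ℝ) := by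
      refine mul_right_cancel₀ (mul_pos (hr0 k) (hr0 (k + 1))).ne' ?_
      linear_combination a k * r (k + 1) * hac k - jacobiA α β k * r (k + 1) * hac' k
    have h1 := abs_mul_sub_quarter_le (t := 1 / ((k : ℝ) + 1)) (M := M) (N := N)
      (by simpa [div_eq_mul_inv] using hAM k)
      (b := jacobiC α β ((k + 1 : ℕ) : ℝ)) ?_ hM hN (by positivity) ?_
    · refine (abs_sub_half_le_of_sq ha0 ha2).trans ?_
      calc _ ≤ 2 * ((M * N + M + N) * (1 / ((k : ℝ) + 1))) := by gcongr
        _ = _ := by ring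
    · refine (hCN (k + 1)).trans ?_
      rw [mul_one_div]
      push_cast
      gcongr
      linarith
    · rw [div_le_one (by positivity)]
      linarith [(k.cast_nonneg : (0 : ℝ) ≤ k)]
  have hbM : ∀ k : ℕ, |b k| ≤ 2 * (M * N + M + N) / (k + 1) := by
    intro k
    refine le_trans ?_ (hle k)
    have e : b k = -((jacobiA α β k - 1 / 2) + (jacobiC α β k - 1 / 2)) := by
      simp only [hb]
      ring
    rw [e, abs_neg, add_div]
    exact (abs_add_le _ _).trans (add_le_add (hAM k) (hCN k))
  obtain ⟨C, hC⟩ := exists_integral_inv_one_add_sq_le (α := α) (β := β) (by linarith) hα hβ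
    (by linarith)
  obtain ⟨D, hD⟩ := exists_integral_abs_hatKernel_le hint hpc horth Real.continuous_cos hrec
    haM hbM hC
  have hpb : ∀ k, ∃ B, ∀ θ, |p k θ| ≤ B := fun k => by
    obtain ⟨B, hB⟩ := exists_abs_jacobiQ_comp_cos_le α β k
    refine ⟨B / r k, fun θ => ?_⟩
    simp only [hp]
    rw [abs_div, abs_of_pos (hr0 k)]
    exact div_le_div_of_nonneg_right (hB θ) (hr0 k).le
  obtain ⟨f, hf, hfk⟩ := exists_integrable_le_abs_coeff hint hpc hpb horth hD hη
  refine ⟨f, hf, fun k hk => ?_⟩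
  have h1 : ∫ θ, f θ * jacobiQ α β k ((Real.cos θ - 1) / 2) ∂jacobiMeasure α β
      = r k * ∫ θ, f θ * p k θ ∂jacobiMeasure α β := by
    rw [← integral_const_mul]
    congr 1
    funext θ
    have := (hr0 k).ne'
    simp only [hp]
    field_simp
  rw [h1, abs_mul, abs_of_pos (hr0 k)]
  exact mul_le_mul_of_nonneg_left (hfk k hk) (hr0 k).le

theorem fourierJacobi_eq_integral (hα : -1 < α) (hβ : -1 < β) (f : ℝ → ℝ) (k : ℕ) :
    fourierJacobi α β f k
      = ∫ θ, f θ * jacobiQ α β k ((Real.cos θ - 1) / 2) ∂jacobiMeasure α β := by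
  rw [integral_jacobiMeasure, fourierJacobi]
  simp_rw [jacobiR_eq_jacobiQ (by linarith : 0 < α + 1) (by linarith : 0 < β + 1)]

end Construction

/-- For `-1 < β ≤ α < -1/2` there exists `f* ∈ L_{(α,β)}` whose Fourier–Jacobi
coefficients satisfy `|f̂*_{(α,β)}(k)| → ∞` as `k → ∞`. -/
theorem exists_jacobi_coeff_tendsto_atTop (α β : ℝ) (hβ : -1 < β) (hβα : β ≤ α)
    (hα : α < -(1/2)) :
    ∃ f : ℝ → ℝ, MemJacobiL α β f ∧
      Tendsto (fun k : ℕ => |fourierJacobi α β f k|) atTop atTop := by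
  obtain ⟨δ, hδ⟩ : ∃ δ, δ = (-1 - 2 * α) / 2 := ⟨_, rfl⟩
  have hδ0 : 0 < δ := by linarith
  obtain ⟨c, hc, hcn⟩ := exists_pos_mul_rpow_le_jacobiNormSq hβ hβα hα
  obtain ⟨f, hf, hfk⟩ := exists_integrable_le_abs_integral_jacobiQ hβ hβα hα
    (by positivity : 0 < δ / 4)
  refine ⟨f, (integrable_jacobiMeasure_iff α β f).1 hf, ?_⟩
  have hlim : Tendsto (fun k : ℕ => √c * 2 ^ (-(δ / 4)) / 4 * (k : ℝ) ^ (δ / 4)) atTop atTop :=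
    ((tendsto_rpow_atTop (by positivity)).comp tendsto_natCast_atTop_atTop).const_mul_atTop
      (by positivity)
  refine tendsto_atTop_mono' _ ?_ hlim
  filter_upwards [hcn, eventually_gt_atTop 0] with k hk hk0
  have hk0' : (0 : ℝ) < k := by exact_mod_cast hk0
  rw [fourierJacobi_eq_integral (by linarith) hβ]
  refine le_trans ?_ (hfk k hk0)
  rw [← hδ] at hk
  have h1 : √c * (k : ℝ) ^ (δ / 2) ≤ √(jacobiNormSq α β k) := by
    refine le_of_eq_of_le ?_ (Real.sqrt_le_sqrt hk)
    rw [Real.sqrt_mul hc.le, Real.sqrt_eq_rpow ((k : ℝ) ^ δ), ← Real.rpow_mul hk0'.le, mul_one_div]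
  have h2 : (k : ℝ) ^ (δ / 4) = (k : ℝ) ^ (δ / 2) * (k : ℝ) ^ (-(δ / 4)) := by
    rw [← Real.rpow_add hk0']
    ring_nf
  calc √c * 2 ^ (-(δ / 4)) / 4 * (k : ℝ) ^ (δ / 4)
      = √c * (k : ℝ) ^ (δ / 2) * ((2 * (k : ℝ)) ^ (-(δ / 4)) / 4) := by
        rw [h2, Real.mul_rpow two_pos.le hk0'.le]
        ring
    _ ≤ _ := by gcongr
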